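/- arXiv:2501.07648 — 12 statements merged into one kernel-verified Lean document; each statement's English description precedes it below -/
import Mathlib

section
/- Let (X, d, μ) be a compact metric-measure space with card(X) ≥ 3, and let ι_d : X → L²(μ) be the canonical map. Then there exists s > 0 such that for all x, y ∈ X one has ⟨ι_d(x), ι_d(y)⟩ = ∫_X d(x, z)·d(y, z) dμ(z) ≥ s > 0. -/
open MeasureTheory

/-- Let `(X, d, μ)` be a compact metric-measure space with at least
three points.  Then there is `s > 0` such that
`⟨ι_d x, ι_d y⟩ = ∫ d(x,z) d(y,z) dμ(z) ≥ s > 0` for all `x, y ∈ X`. -/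
theorem canonical_map_inner_uniformly_positive
    {X : Type*} [MetricSpace X] [CompactSpace X]
    [MeasurableSpace X] [BorelSpace X]
    (μ : Measure X) [IsFiniteMeasure μ] [μ.Regular] [μ.IsOpenPosMeasure]
    (hcard : ∃ x y z : X, x ≠ y ∧ x ≠ z ∧ y ≠ z) :
    ∃ s : ℝ, 0 < s ∧ ∀ x y : X, s ≤ ∫ z, dist x z * dist y z ∂μ := by
  obtain ⟨a, b, c, hab, hac, hbc⟩ := hcard
  have : Nonempty X := ⟨a⟩
  have hcont : Continuous fun p : X × X => ∫ z, dist p.1 z * dist p.2 z ∂μ := by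
    have h := continuous_parametric_integral_of_continuous (μ := μ)
      (f := fun (p : X × X) z => dist p.1 z * dist p.2 z)
      (by simp only [Function.uncurry_def]; fun_prop) isCompact_univ
    simpa only [Measure.restrict_univ] using h
  obtain ⟨p, -, hp⟩ := isCompact_univ.exists_isMinOn Set.univ_nonempty hcont.continuousOn
  refine ⟨_, ?_, fun x y => hp (Set.mem_univ (x, y))⟩
  obtain ⟨w, hw₁, hw₂⟩ : ∃ w, p.1 ≠ w ∧ p.2 ≠ w := by
    by_contra! h
    have ha := or_iff_not_imp_left.2 (h a)
    have hb := or_iff_not_imp_left.2 (h b)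
    have hc := or_iff_not_imp_left.2 (h c)
    grind
  exact Continuous.integral_pos_of_hasCompactSupport_nonneg_nonzero (x := w)
    (by fun_prop) (HasCompactSupport.of_compactSpace _)
    (fun z => mul_nonneg dist_nonneg dist_nonneg)
    (mul_ne_zero (dist_ne_zero.2 hw₁) (dist_ne_zero.2 hw₂))
end

section
/- Let (X, d, μ) be a metric-measure space with finite diameter and let ι_d : X → L²(μ) be the canonical map. If x, y ∈ X and r > 0 are such that ι_d(x) = r·ι_d(y) in L²(μ) (i.e. d(x, z) = r·d(y, z) for μ-almost every z ∈ X), then x = y. In particular, the radial projection u ↦ u/‖u‖₂ is injective on the set ι_d(X). -/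
open MeasureTheory

/-- Let `(X, d, μ)` be a metric-measure space with finite diameter and
`ι_d : X → L²(μ)` the canonical map.  If `x, y ∈ X` and `r > 0` are such that
`ι_d x = r • ι_d y` in `L²(μ)`, i.e. `d(x,z) = r * d(y,z)` for `μ`-a.e. `z`, then `x = y`.
(In particular the radial projection is injective on `ι_d(X)`.) -/
theorem canonical_map_radial_injective
    {X : Type*} [MetricSpace X]
    [MeasurableSpace X] [BorelSpace X]
    (μ : Measure X) [IsFiniteMeasure μ] [μ.Regular] [μ.IsOpenPosMeasure]
    (hμ : μ Set.univ ≠ 0)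
    (hdiam : EMetric.diam (Set.univ : Set X) ≠ ⊤)
    (x y : X) (r : ℝ) (hr : 0 < r)
    (h : ∀ᵐ z ∂μ, dist x z = r * dist y z) :
    x = y := by
  have heq : (fun z => dist x z) = fun z => r * dist y z :=
    Measure.eq_of_ae_eq h (by fun_prop) (by fun_prop)
  have hx : r * dist y x = 0 := by simpa using (congrFun heq x).symm
  exact (dist_eq_zero.mp ((mul_eq_zero.mp hx).resolve_left hr.ne')).symm
end

section
/- Let (X, d, μ) be a compact metric-measure space with card(X) ≥ 3 and let ι_d : X → L²(μ) be the canonical map. Then there exist x₀, y₀ ∈ X such that 0 < ⟨ι_d(x₀), ι_d(y₀)⟩/(‖ι_d(x₀)‖₂·‖ι_d(y₀)‖₂) ≤ ⟨ι_d(x), ι_d(y)⟩/(‖ι_d(x)‖₂·‖ι_d(y)‖₂) for all x, y ∈ X; that is, the cosine of the spherical angle between ι_d(x) and ι_d(y) attains a strictly positive minimum. -/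
open MeasureTheory

/-- On a compact metric space with a finite measure, the integral of a jointly continuous kernel
depends continuously on the parameter. -/
theorem continuous_integral_of_compactSpace
    {X Y : Type*} [TopologicalSpace Y] [FirstCountableTopology Y] [LocallyCompactSpace Y]
    [MetricSpace X] [CompactSpace X] [MeasurableSpace X] [BorelSpace X]
    (μ : Measure X) [IsFiniteMeasure μ] {f : Y → X → ℝ} (hf : Continuous f.uncurry) :
    Continuous fun y => ∫ z, f y z ∂μ := by
  simpa using continuous_parametric_integral_of_continuous (μ := μ) hf isCompact_univ

/-- The functions `dist x` and `dist y` have positive inner product in `L²(μ)` as soon as some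
point is different from both `x` and `y`. -/
theorem integral_dist_mul_dist_pos
    {X : Type*} [MetricSpace X] [CompactSpace X] [MeasurableSpace X] [BorelSpace X]
    (μ : Measure X) [IsFiniteMeasure μ] [μ.IsOpenPosMeasure]
    {x y z : X} (hx : x ≠ z) (hy : y ≠ z) :
    0 < ∫ w, dist x w * dist y w ∂μ :=
  Continuous.integral_pos_of_hasCompactSupport_nonneg_nonzero (x := z) (by fun_prop)
    (HasCompactSupport.of_compactSpace _) (fun _ => by positivity)
    (mul_ne_zero (dist_ne_zero.2 hx) (dist_ne_zero.2 hy))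

/-- Let `(X, d, μ)` be a compact metric-measure space with at least
three points.  Then the cosine of the spherical angle between `ι_d x` and `ι_d y`,
namely `⟨ι_d x, ι_d y⟩ / (‖ι_d x‖₂ * ‖ι_d y‖₂)`, attains a strictly positive minimum
at some pair `(x₀, y₀)`. -/
theorem cosine_of_canonical_map_attains_positive_minimum
    {X : Type*} [MetricSpace X] [CompactSpace X]
    [MeasurableSpace X] [BorelSpace X]
    (μ : Measure X) [IsFiniteMeasure μ] [μ.Regular] [μ.IsOpenPosMeasure]
    (hcard : ∃ x y z : X, x ≠ y ∧ x ≠ z ∧ y ≠ z) :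
    ∃ x₀ y₀ : X,
      0 < (∫ z, dist x₀ z * dist y₀ z ∂μ) /
          (Real.sqrt (∫ z, dist x₀ z ^ 2 ∂μ) * Real.sqrt (∫ z, dist y₀ z ^ 2 ∂μ)) ∧
      ∀ x y : X,
        (∫ z, dist x₀ z * dist y₀ z ∂μ) /
            (Real.sqrt (∫ z, dist x₀ z ^ 2 ∂μ) * Real.sqrt (∫ z, dist y₀ z ^ 2 ∂μ)) ≤
          (∫ z, dist x z * dist y z ∂μ) /
            (Real.sqrt (∫ z, dist x z ^ 2 ∂μ) * Real.sqrt (∫ z, dist y z ^ 2 ∂μ)) := by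
  obtain ⟨a, b, c, hab, hac, hbc⟩ := hcard
  have third (x y : X) : ∃ z, x ≠ z ∧ y ≠ z := by
    by_contra! h
    have h_or (z : X) : x = z ∨ y = z := or_iff_not_imp_left.2 (h z)
    grind [h_or a, h_or b, h_or c]
  have inner_pos (x y : X) : 0 < ∫ z, dist x z * dist y z ∂μ := by
    obtain ⟨z, hx, hy⟩ := third x y
    exact integral_dist_mul_dist_pos μ hx hy
  have norm_pos (x : X) : 0 < √(∫ z, dist x z ^ 2 ∂μ) := by
    simpa only [Real.sqrt_pos, sq] using inner_pos x x
  have inner_cont : Continuous fun p : X × X => ∫ z, dist p.1 z * dist p.2 z ∂μ :=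
    continuous_integral_of_compactSpace μ (by unfold Function.uncurry; fun_prop)
  have norm_cont : Continuous fun x : X => √(∫ z, dist x z ^ 2 ∂μ) :=
    (continuous_integral_of_compactSpace μ (by unfold Function.uncurry; fun_prop)).sqrt
  have cos_cont : Continuous fun p : X × X => (∫ z, dist p.1 z * dist p.2 z ∂μ) /
      (√(∫ z, dist p.1 z ^ 2 ∂μ) * √(∫ z, dist p.2 z ^ 2 ∂μ)) :=
    inner_cont.div ((norm_cont.comp continuous_fst).mul (norm_cont.comp continuous_snd))
      fun p => (mul_pos (norm_pos p.1) (norm_pos p.2)).ne'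
  obtain ⟨⟨x₀, y₀⟩, -, hmin⟩ :=
    isCompact_univ.exists_isMinOn ⟨(a, a), Set.mem_univ _⟩ cos_cont.continuousOn
  exact ⟨x₀, y₀, div_pos (inner_pos x₀ y₀) (mul_pos (norm_pos x₀) (norm_pos y₀)),
    fun x y => hmin (Set.mem_univ (x, y))⟩
end

section
/- Let (X, d) be a metric space with diam(X, d) < ∞ and let 0 < s < 1. Write λ_d(x) for the function z ↦ d(x, z). Then for all x, y ∈ X: (i) sup_{z ∈ X} |d(x, z) − d(y, z)| ≤ (diam(X, d))^{1−s}·d(x, y)^{s}; (ii) sup_{z ≠ w} |(d(x, z) − d(y, z)) − (d(x, w) − d(y, w))| / d(z, w)^{1−s} ≤ 2·d(x, y)^{s}. Consequently the map λ_d : (X, d^{s}) → Lip_{1−s}(X) is Lipschitz with Lipschitz constant at most max{2, (diam(X, d))^{1−s}}, where Lip_{1−s}(X) carries the norm ‖g‖ = max{sup_z |g(z)|, sup_{z ≠ w} |g(z) − g(w)|/d(z, w)^{1−s}}. -/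
theorem Real.min_le_rpow_mul_rpow {a b s : ℝ} (ha : 0 ≤ a) (hb : 0 ≤ b)
    (hs0 : 0 ≤ s) (hs1 : s ≤ 1) : min a b ≤ a ^ s * b ^ (1 - s) := by
  have hm : 0 ≤ min a b := le_min ha hb
  calc min a b = min a b ^ s * min a b ^ (1 - s) := by
        rw [← Real.rpow_add' hm (by simp), add_sub_cancel, Real.rpow_one]
    _ ≤ a ^ s * b ^ (1 - s) := by
        gcongr
        · exact min_le_left a b
        · exact min_le_right a b

theorem abs_dist_sub_dist_le_diam_rpow_mul {X : Type*} [MetricSpace X]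
    (hX : Bornology.IsBounded (Set.univ : Set X)) {s : ℝ} (hs0 : 0 ≤ s) (hs1 : s ≤ 1)
    (x y z : X) :
    |dist x z - dist y z| ≤ Metric.diam (Set.univ : Set X) ^ (1 - s) * dist x y ^ s := by
  have hd : dist x y ≤ Metric.diam (Set.univ : Set X) :=
    Metric.dist_le_diam_of_mem hX (Set.mem_univ x) (Set.mem_univ y)
  calc |dist x z - dist y z| ≤ min (dist x y) (Metric.diam (Set.univ : Set X)) :=
        le_min (abs_dist_sub_le x y z) ((abs_dist_sub_le x y z).trans hd)
    _ ≤ dist x y ^ s * Metric.diam (Set.univ : Set X) ^ (1 - s) :=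
        Real.min_le_rpow_mul_rpow dist_nonneg Metric.diam_nonneg hs0 hs1
    _ = _ := mul_comm _ _

theorem abs_dist_sub_dist_sub_le_rpow_mul {X : Type*} [MetricSpace X]
    {s : ℝ} (hs0 : 0 ≤ s) (hs1 : s ≤ 1) (x y z w : X) :
    |(dist x z - dist y z) - (dist x w - dist y w)| ≤
      2 * dist x y ^ s * dist z w ^ (1 - s) := by
  have hxy : |(dist x z - dist y z) - (dist x w - dist y w)| ≤ 2 * dist x y := by
    have h := abs_sub (dist x z - dist y z) (dist x w - dist y w)
    linarith [abs_dist_sub_le x y z, abs_dist_sub_le x y w]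
  have hzw : |(dist x z - dist y z) - (dist x w - dist y w)| ≤ 2 * dist z w := by
    have h := abs_sub (dist z x - dist w x) (dist z y - dist w y)
    rw [sub_sub_sub_comm, dist_comm x z, dist_comm x w, dist_comm y z, dist_comm y w]
    linarith [abs_dist_sub_le z w x, abs_dist_sub_le z w y]
  have hmin := Real.min_le_rpow_mul_rpow (a := dist x y) (b := dist z w)
    dist_nonneg dist_nonneg hs0 hs1
  rcases min_cases (dist x y) (dist z w) with h | h <;> linarith

/-- Let `(X, d)` be a metric space of finite diameter and `0 < s < 1`.
Then for all `x, y ∈ X`: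
(i) `sup_z |d(x,z) − d(y,z)| ≤ diam(X)^{1−s} · d(x,y)^s`;
(ii) `sup_{z ≠ w} |(d(x,z) − d(y,z)) − (d(x,w) − d(y,w))| / d(z,w)^{1−s} ≤ 2 d(x,y)^s`;
hence `λ_d : (X, dˢ) → Lip_{1−s}(X)` is Lipschitz with constant at most
`max {2, diam(X)^{1−s}}`. -/
theorem lambda_lipschitz_on_snowflake
    {X : Type*} [MetricSpace X]
    (hdiam : EMetric.diam (Set.univ : Set X) ≠ ⊤)
    (s : ℝ) (hs0 : 0 < s) (hs1 : s < 1) :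
    ∀ x y : X,
      ((⨆ z : X, |dist x z - dist y z|) ≤
        Metric.diam (Set.univ : Set X) ^ (1 - s) * dist x y ^ s) ∧
      ((⨆ q : {q : X × X // q.1 ≠ q.2},
          |(dist x q.1.1 - dist y q.1.1) - (dist x q.1.2 - dist y q.1.2)| /
            dist q.1.1 q.1.2 ^ (1 - s)) ≤ 2 * dist x y ^ s) ∧
      max (⨆ z : X, |dist x z - dist y z|)
          (⨆ q : {q : X × X // q.1 ≠ q.2},
            |(dist x q.1.1 - dist y q.1.1) - (dist x q.1.2 - dist y q.1.2)| /
              dist q.1.1 q.1.2 ^ (1 - s)) ≤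
        max 2 (Metric.diam (Set.univ : Set X) ^ (1 - s)) * dist x y ^ s := by
  intro x y
  have hX : Bornology.IsBounded (Set.univ : Set X) := Metric.isBounded_iff_ediam_ne_top.2 hdiam
  have hsup : (⨆ z : X, |dist x z - dist y z|) ≤
      Metric.diam (Set.univ : Set X) ^ (1 - s) * dist x y ^ s :=
    Real.iSup_le (abs_dist_sub_dist_le_diam_rpow_mul hX hs0.le hs1.le x y) (by positivity)
  have hlip : (⨆ q : {q : X × X // q.1 ≠ q.2},
      |(dist x q.1.1 - dist y q.1.1) - (dist x q.1.2 - dist y q.1.2)| /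
        dist q.1.1 q.1.2 ^ (1 - s)) ≤ 2 * dist x y ^ s := by
    refine Real.iSup_le (fun q => ?_) (by positivity)
    rw [div_le_iff₀ (Real.rpow_pos_of_pos (dist_pos.2 q.2) _)]
    exact abs_dist_sub_dist_sub_le_rpow_mul hs0.le hs1.le x y q.1.1 q.1.2
  refine ⟨hsup, hlip, max_le (hsup.trans ?_) (hlip.trans ?_)⟩
  · gcongr
    exact le_max_right _ _
  · gcongr
    exact le_max_left _ _
end

section
/- Let (X, d, μ) be a compact metric-measure space and assume that every atom of μ is an isolated point of X. Let ι_d : X → L²(μ) be the canonical map, define the metric ρ_d on X by ρ_d(x, y) = ‖ι_d(x) − ι_d(y)‖₂, and let ι_{ρ_d} : X → L²(μ) be the canonical map of the metric ρ_d, i.e. ι_{ρ_d}(x) is the function z ↦ ρ_d(x, z). If there exists ℓ > 0 such that ℓ·d(x, y) ≤ ‖ι_{ρ_d}(x) − ι_{ρ_d}(y)‖₂ for all x, y ∈ X, then there exist N ∈ ℕ and a bi-Lipschitz embedding of (X, d) into ℝ^N. -/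
open MeasureTheory
open scoped Topology

/-- The difference of the distances from `x` and from `y` to `z` in a Hilbert space is the inner
product of `x - y` with this vector of norm at most one. -/
noncomputable def distDiffDirection {H : Type*} [NormedAddCommGroup H] [InnerProductSpace ℝ H]
    (z x y : H) : H :=
  (‖x - z‖ + ‖y - z‖)⁻¹ • ((x - z) + (y - z))

section InnerProduct

variable {H : Type*} [NormedAddCommGroup H] [InnerProductSpace ℝ H]

lemma inner_distDiffDirection (z x y : H) :
    inner ℝ (x - y) (distDiffDirection z x y) = ‖x - z‖ - ‖y - z‖ := by
  have hin : inner ℝ (x - y) ((x - z) + (y - z)) = ‖x - z‖ ^ 2 - ‖y - z‖ ^ 2 := by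
    rw [show x - y = (x - z) - (y - z) by abel, inner_sub_left, inner_add_right, inner_add_right,
      real_inner_self_eq_norm_sq, real_inner_self_eq_norm_sq, real_inner_comm (x - z) (y - z)]
    ring
  rw [distDiffDirection, inner_smul_right, hin]
  rcases eq_or_ne (‖x - z‖ + ‖y - z‖) 0 with h | h
  · have h1 := norm_nonneg (x - z)
    have h2 := norm_nonneg (y - z)
    rw [h]
    simp only [inv_zero, zero_mul]
    linarith
  · field_simp
    ring

lemma continuousAt_distDiffDirection {z p : H} (h : z ≠ p) :
    ContinuousAt (fun q : H × H × H => distDiffDirection q.1 q.2.1 q.2.2) (z, p, p) := by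
  have hp : 0 < ‖p - z‖ := norm_pos_iff.2 (sub_ne_zero.2 h.symm)
  unfold distDiffDirection
  refine ContinuousAt.smul (ContinuousAt.inv₀ (by fun_prop) ?_) (by fun_prop)
  simp only
  positivity

/-- Near a point `p` off the compact set `K`, the functions `z ↦ distDiffDirection (j z) (j x) (j y)`
on `K` take values close to those at finitely many points. -/
lemma exists_finset_distDiffDirection_near {X : Type*} [TopologicalSpace X] {j : X → H}
    (hj : Continuous j) (hinj : Function.Injective j) {K : Set X} (hK : IsCompact K) {p : X}
    (hp : p ∉ K) {ε : ℝ} (hε : 0 < ε) :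
    ∃ F : Finset X, ∀ᶠ q : X × X in 𝓝 (p, p), ∀ z ∈ K, ∃ w ∈ F,
      ‖distDiffDirection (j z) (j q.1) (j q.2) - distDiffDirection (j w) (j q.1) (j q.2)‖ < ε := by
  classical
  refine hK.induction_on (p := fun S => ∃ F : Finset X, ∀ᶠ q : X × X in 𝓝 (p, p), ∀ z ∈ S, ∃ w ∈ F,
      ‖distDiffDirection (j z) (j q.1) (j q.2) - distDiffDirection (j w) (j q.1) (j q.2)‖ < ε)
      ?_ ?_ ?_ ?_
  · exact ⟨∅, by simp⟩
  · rintro s t hst ⟨F, hF⟩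
    exact ⟨F, hF.mono fun q hq z hz => hq z (hst hz)⟩
  · rintro s t ⟨F, hF⟩ ⟨G, hG⟩
    refine ⟨F ∪ G, ?_⟩
    filter_upwards [hF, hG] with q hq hq' z hz
    rcases hz with hz | hz
    · obtain ⟨w, hw, h⟩ := hq z hz
      exact ⟨w, Finset.mem_union_left _ hw, h⟩
    · obtain ⟨w, hw, h⟩ := hq' z hz
      exact ⟨w, Finset.mem_union_right _ hw, h⟩
  · intro w hw
    have hne : j w ≠ j p := fun h => hp (hinj h ▸ hw)
    have hc : ContinuousAt (fun q : X × X × X =>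
        distDiffDirection (j q.1) (j q.2.1) (j q.2.2)) (w, p, p) :=
      ContinuousAt.comp (f := fun q : X × X × X => (j q.1, j q.2.1, j q.2.2)) (x := (w, p, p))
        (continuousAt_distDiffDirection hne) (by fun_prop)
    have hc' : ContinuousAt (fun q : X × X × X =>
        distDiffDirection (j w) (j q.2.1) (j q.2.2)) (w, p, p) :=
      ContinuousAt.comp (f := fun q : X × X × X => (w, q.2.1, q.2.2)) (x := (w, p, p)) hc
        (by fun_prop)
    have hev : ∀ᶠ q : X × X × X in 𝓝 (w, p, p),
        ‖distDiffDirection (j q.1) (j q.2.1) (j q.2.2) -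
          distDiffDirection (j w) (j q.2.1) (j q.2.2)‖ < ε :=
      (hc.sub hc').norm.eventually_lt continuousAt_const (by simpa using hε)
    rw [nhds_prod_eq] at hev
    obtain ⟨P, hP, Q, hQ, hPQ⟩ := Filter.eventually_prod_iff.1 hev
    refine ⟨{z | P z}, mem_nhdsWithin_of_mem_nhds hP, {w}, ?_⟩
    filter_upwards [hQ] with q hq z hz
    exact ⟨w, Finset.mem_singleton_self w, hPQ hz hq⟩

end InnerProduct

section CanonicalMap

variable {X : Type*} [MetricSpace X] [CompactSpace X] [MeasurableSpace X] [BorelSpace X]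

/-- The canonical map sending `x` to the function `z ↦ dist x z` in `L²(μ)`. -/
noncomputable def canonicalMap (μ : Measure X) [IsFiniteMeasure μ] (x : X) : Lp ℝ 2 μ :=
  ContinuousMap.toLp 2 μ ℝ ⟨fun z => dist x z, by fun_prop⟩

variable (μ : Measure X) [IsFiniteMeasure μ]

lemma norm_canonicalMap_sub (x y : X) :
    ‖canonicalMap μ x - canonicalMap μ y‖ = √(∫ z, (dist x z - dist y z) ^ 2 ∂μ) := by
  rw [canonicalMap, canonicalMap, ← map_sub, norm_eq_sqrt_real_inner, ContinuousMap.inner_toLp]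
  congr 1
  refine integral_congr_ae (.of_forall fun z => ?_)
  simp [sq]

lemma norm_canonicalMap_sub_le (x y : X) :
    ‖canonicalMap μ x - canonicalMap μ y‖ ≤ √(μ.real Set.univ) * dist x y := by
  rw [norm_canonicalMap_sub]
  refine Real.sqrt_le_iff.2 ⟨by positivity, ?_⟩
  rw [mul_pow, Real.sq_sqrt measureReal_nonneg, ← smul_eq_mul, ← integral_const]
  refine integral_mono_of_nonneg (.of_forall fun z => sq_nonneg _) (integrable_const _)
    (.of_forall fun z => ?_)
  exact sq_le_sq.2 ((abs_dist_sub_le x y z).trans (le_abs_self _))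

lemma lipschitzWith_canonicalMap :
    LipschitzWith (√(μ.real Set.univ)).toNNReal (canonicalMap μ) :=
  LipschitzWith.of_dist_le_mul fun x y => by
    rw [dist_eq_norm, Real.coe_toNNReal _ (Real.sqrt_nonneg _)]
    exact norm_canonicalMap_sub_le μ x y

lemma canonicalMap_injective [μ.IsOpenPosMeasure] : Function.Injective (canonicalMap μ) := by
  intro x y h
  have := congrArg (fun f : C(X, ℝ) => f y) (ContinuousMap.toLp_injective μ h)
  simpa using this

/-- Around a null point, finitely many of the functions `x ↦ ‖canonicalMap μ x - canonicalMap μ z‖`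
already detect the distance, provided all of them do so in the mean square. -/
lemma exists_finset_lower_bound_near [μ.OuterRegular] [μ.IsOpenPosMeasure] {p : X}
    (hp : μ {p} = 0) {ℓ : ℝ} (hℓ : 0 < ℓ)
    (hlow : ∀ x y : X, ℓ * dist x y ≤ √(∫ z, (‖canonicalMap μ x - canonicalMap μ z‖ -
      ‖canonicalMap μ y - canonicalMap μ z‖) ^ 2 ∂μ)) :
    ∃ F : Finset X, ∃ c > 0, ∀ᶠ q : X × X in 𝓝 (p, p), q.1 ≠ q.2 → ∃ w ∈ F,
      c * dist q.1 q.2 ≤ |‖canonicalMap μ q.1 - canonicalMap μ w‖ -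
        ‖canonicalMap μ q.2 - canonicalMap μ w‖| := by
  set j := canonicalMap μ
  set M := √(μ.real Set.univ) with hM
  have hM0 : 0 ≤ M := Real.sqrt_nonneg _
  have hMsq : M ^ 2 = μ.real Set.univ := Real.sq_sqrt measureReal_nonneg
  obtain ⟨U, hpU, hU, hμU⟩ := Set.exists_isOpen_lt_of_lt {p}
    (ENNReal.ofReal (ℓ ^ 2 / (4 * (M ^ 2 + 1)))) (by rw [hp, ENNReal.ofReal_pos]; positivity)
  have hμU' : μ.real U * M ^ 2 ≤ ℓ ^ 2 / 4 := by
    have h1 : μ.real U ≤ ℓ ^ 2 / (4 * (M ^ 2 + 1)) :=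
      ENNReal.toReal_le_of_le_ofReal (by positivity) hμU.le
    calc μ.real U * M ^ 2 ≤ ℓ ^ 2 / (4 * (M ^ 2 + 1)) * (M ^ 2 + 1) := by
          gcongr; linarith
      _ = ℓ ^ 2 / 4 := by field_simp
  set ε := ℓ / (2 * (1 + M) ^ 2) with hε
  have hε0 : 0 < ε := by positivity
  have hεM : ((1 + M) * ε) ^ 2 * M ^ 2 ≤ ℓ ^ 2 / 4 := by
    have h1 : (1 + M) * ε * M ≤ ℓ / 2 := by
      calc (1 + M) * ε * M ≤ (1 + M) * ε * (1 + M) := by gcongr; linarith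
        _ = ℓ / 2 := by rw [hε]; field_simp
    calc ((1 + M) * ε) ^ 2 * M ^ 2 = ((1 + M) * ε * M) ^ 2 := by ring
      _ ≤ (ℓ / 2) ^ 2 := by gcongr
      _ = ℓ ^ 2 / 4 := by ring
  obtain ⟨F, hF⟩ := exists_finset_distDiffDirection_near (lipschitzWith_canonicalMap μ).continuous
    (canonicalMap_injective μ) hU.isClosed_compl.isCompact
    (fun h => h (hpU rfl) : p ∉ Uᶜ) hε0
  refine ⟨F, ε, hε0, hF.mono ?_⟩
  rintro ⟨x, y⟩ hq hxy
  simp only at hq hxy ⊢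
  by_contra! hcon
  have hd : 0 < dist x y := dist_pos.2 hxy
  have hMd : ‖j x - j y‖ ≤ M * dist x y := norm_canonicalMap_sub_le μ x y
  have hbound (z : X) : (‖j x - j z‖ - ‖j y - j z‖) ^ 2 ≤
      ((1 + M) * ε * dist x y) ^ 2 + U.indicator (fun _ => (M * dist x y) ^ 2) z := by
    by_cases hz : z ∈ U
    · rw [Set.indicator_of_mem hz]
      have h1 : |‖j x - j z‖ - ‖j y - j z‖| ≤ M * dist x y := by
        refine (abs_norm_sub_norm_le _ _).trans ?_
        rwa [sub_sub_sub_cancel_right]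
      have h2 := sq_le_sq.2 (h1.trans (le_abs_self _))
      have h3 := sq_nonneg ((1 + M) * ε * dist x y)
      linarith
    · rw [Set.indicator_of_notMem hz, add_zero]
      obtain ⟨w, hw, hzw⟩ := hq z hz
      have h1 := hcon w hw
      have h2 : |inner ℝ (j x - j y) (distDiffDirection (j z) (j x) (j y) -
          distDiffDirection (j w) (j x) (j y))| ≤ M * dist x y * ε :=
        (abs_real_inner_le_norm _ _).trans
          (mul_le_mul hMd hzw.le (norm_nonneg _) (by positivity))
      rw [inner_sub_right, inner_distDiffDirection, inner_distDiffDirection] at h2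
      refine sq_le_sq.2 (le_trans ?_ (le_abs_self _))
      rw [abs_le] at h2 ⊢
      rw [abs_lt] at h1
      constructor <;> linarith [h1.1, h1.2, h2.1, h2.2]
  have hint : ∫ z, (‖j x - j z‖ - ‖j y - j z‖) ^ 2 ∂μ ≤
      ((1 + M) * ε * dist x y) ^ 2 * M ^ 2 + (M * dist x y) ^ 2 * μ.real U := by
    have hi : Integrable (U.indicator fun _ => (M * dist x y) ^ 2) μ :=
      (integrable_const _).indicator hU.measurableSet
    refine (integral_mono_of_nonneg (.of_forall fun z => sq_nonneg _)
      ((integrable_const _).add hi) (.of_forall hbound)).trans_eq ?_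
    simp only [Pi.add_apply]
    rw [integral_add (integrable_const _) hi, integral_const, integral_indicator hU.measurableSet,
      setIntegral_const, hMsq, smul_eq_mul, smul_eq_mul]
    ring
  have hsq : (ℓ * dist x y) ^ 2 ≤ ∫ z, (‖j x - j z‖ - ‖j y - j z‖) ^ 2 ∂μ :=
    (Real.le_sqrt' (by positivity)).1 (hlow x y)
  have hd2 : 0 < dist x y ^ 2 := by positivity
  nlinarith [mul_le_mul_of_nonneg_right hεM hd2.le, mul_le_mul_of_nonneg_right hμU' hd2.le,
    mul_pos hd2 (pow_pos hℓ 2)]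

end CanonicalMap

/-- A finite family of Lipschitz functions detecting the distance gives a bi-Lipschitz map into a
Euclidean space. -/
lemma exists_biLipschitz_euclidean_of_finset {X : Type*} [MetricSpace X] (F : Finset (X → ℝ))
    (hF : ∀ g ∈ F, ∃ L, LipschitzWith L g) {c : ℝ} (hc : 0 < c)
    (h : ∀ x y, x ≠ y → ∃ g ∈ F, c * dist x y ≤ |g x - g y|) :
    ∃ (N : ℕ) (f : X → EuclideanSpace ℝ (Fin N)) (a b : ℝ), 0 < a ∧ a ≤ b ∧
      ∀ x y : X, a * dist x y ≤ dist (f x) (f y) ∧ dist (f x) (f y) ≤ b * dist x y := by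
  have hL (i : Fin F.card) : ∃ L, LipschitzWith L (F.equivFin.symm i : X → ℝ) :=
    hF _ (F.equivFin.symm i).2
  choose L hL using hL
  let f : X → EuclideanSpace ℝ (Fin F.card) := fun x =>
    WithLp.toLp 2 fun i => (F.equivFin.symm i : X → ℝ) x
  obtain ⟨b, hb⟩ : ∃ b, LipschitzWith b f :=
    ⟨_, (PiLp.lipschitzWith_toLp 2 fun _ : Fin F.card => ℝ).comp
      (LipschitzWith.of_dist_le_mul (K := ∑ i, L i) fun x y => by
        refine (dist_pi_le_iff (by positivity)).2 fun i => ((hL i).dist_le_mul x y).trans ?_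
        gcongr
        exact Finset.single_le_sum (f := L) (fun _ _ => zero_le) (Finset.mem_univ i))⟩
  refine ⟨F.card, f, c, max b c, hc, le_max_right _ _, fun x y => ⟨?_, ?_⟩⟩
  · rcases eq_or_ne x y with rfl | hxy
    · simp
    · obtain ⟨g, hg, hgc⟩ := h x y hxy
      refine hgc.trans ?_
      have := PiLp.norm_apply_le (f x - f y) (F.equivFin ⟨g, hg⟩)
      simpa [f, dist_eq_norm] using this
  · refine (hb.dist_le_mul x y).trans ?_
    gcongr
    exact le_max_left _ _

/-- In a compact space, functions detecting the distance locally on the square give a bi-Lipschitz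
map into a Euclidean space. -/
lemma exists_biLipschitz_euclidean_of_eventually {X : Type*} [MetricSpace X] [CompactSpace X]
    (h : ∀ p : X × X, ∃ F : Finset (X → ℝ), (∀ g ∈ F, ∃ L, LipschitzWith L g) ∧ ∃ c > 0,
      ∀ᶠ q in 𝓝 p, q.1 ≠ q.2 → ∃ g ∈ F, c * dist q.1 q.2 ≤ |g q.1 - g q.2|) :
    ∃ (N : ℕ) (f : X → EuclideanSpace ℝ (Fin N)) (a b : ℝ), 0 < a ∧ a ≤ b ∧
      ∀ x y : X, a * dist x y ≤ dist (f x) (f y) ∧ dist (f x) (f y) ≤ b * dist x y := by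
  classical
  obtain ⟨F, hF, c, hc, hFc⟩ : ∃ F : Finset (X → ℝ), (∀ g ∈ F, ∃ L, LipschitzWith L g) ∧ ∃ c > 0,
      ∀ q ∈ (Set.univ : Set (X × X)), q.1 ≠ q.2 → ∃ g ∈ F, c * dist q.1 q.2 ≤ |g q.1 - g q.2| := by
    refine isCompact_univ.induction_on (p := fun S : Set (X × X) => ∃ F : Finset (X → ℝ),
      (∀ g ∈ F, ∃ L, LipschitzWith L g) ∧ ∃ c > 0,
      ∀ q ∈ S, q.1 ≠ q.2 → ∃ g ∈ F, c * dist q.1 q.2 ≤ |g q.1 - g q.2|) ?_ ?_ ?_ ?_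
    · exact ⟨∅, by simp, 1, one_pos, by simp⟩
    · rintro s t hst ⟨F, hF, c, hc, hFc⟩
      exact ⟨F, hF, c, hc, fun q hq => hFc q (hst hq)⟩
    · rintro s t ⟨F, hF, c, hc, hFc⟩ ⟨G, hG, e, he, hGe⟩
      refine ⟨F ∪ G, fun g hg => (Finset.mem_union.1 hg).elim (hF g) (hG g), min c e,
        lt_min hc he, fun q hq hne => ?_⟩
      rcases hq with hq | hq
      · obtain ⟨g, hg, hgq⟩ := hFc q hq hne
        refine ⟨g, Finset.mem_union_left _ hg, le_trans ?_ hgq⟩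
        gcongr
        exact min_le_left _ _
      · obtain ⟨g, hg, hgq⟩ := hGe q hq hne
        refine ⟨g, Finset.mem_union_right _ hg, le_trans ?_ hgq⟩
        gcongr
        exact min_le_right _ _
    · intro p _
      obtain ⟨F, hF, c, hc, hFc⟩ := h p
      exact ⟨_, mem_nhdsWithin_of_mem_nhds hFc, F, hF, c, hc, fun q hq => hq⟩
  exact exists_biLipschitz_euclidean_of_finset F hF hc fun x y => hFc (x, y) trivial

/-- The distance to `x` detects the distance between points near `x` and points near `y ≠ x`. -/
lemma eventually_lower_bound_dist_of_ne {X : Type*} [MetricSpace X] {x y : X} (hxy : x ≠ y) :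
    ∀ᶠ q : X × X in 𝓝 (x, y), 1 / 2 * dist q.1 q.2 ≤ |dist q.1 x - dist q.2 x| := by
  have hd : 0 < dist y x := dist_pos.2 hxy.symm
  refine (ContinuousAt.eventually_lt (f := fun q : X × X => 1 / 2 * dist q.1 q.2)
    (g := fun q : X × X => |dist q.1 x - dist q.2 x|) (by fun_prop) (by fun_prop) ?_).mono
    fun q hq => hq.le
  simp only [dist_self, zero_sub, abs_neg, abs_of_pos hd, dist_comm x y]
  linarith

/-- **Theorem `iotarho`.** Let `(X, d, μ)` be a compact metric-measure
space whose atoms are isolated points.  Let `ρ_d(x,y) = ‖ι_d x − ι_d y‖₂` and let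
`ι_{ρ_d}` be the canonical map of `ρ_d`.  If `ι_{ρ_d} : (X, d) → L²(μ)` is lower
Lipschitz, then `(X, d)` admits a bi-Lipschitz embedding into some `ℝ^N`. -/
theorem biLipschitz_embedding_of_iota_rho_lower_Lipschitz
    {X : Type*} [MetricSpace X] [CompactSpace X]
    [MeasurableSpace X] [BorelSpace X]
    (μ : Measure X) [IsFiniteMeasure μ] [μ.Regular] [μ.IsOpenPosMeasure]
    (hatoms : ∀ x : X, μ {x} ≠ 0 → 𝓝[≠] x = ⊥)
    (ρ : X → X → ℝ)
    (hρ : ∀ x y : X, ρ x y = Real.sqrt (∫ z, (dist x z - dist y z) ^ 2 ∂μ))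
    (ℓ : ℝ) (hℓ : 0 < ℓ)
    (hlow : ∀ x y : X, ℓ * dist x y ≤ Real.sqrt (∫ z, (ρ x z - ρ y z) ^ 2 ∂μ)) :
    ∃ (N : ℕ) (f : X → EuclideanSpace ℝ (Fin N)) (a b : ℝ), 0 < a ∧ a ≤ b ∧
      ∀ x y : X, a * dist x y ≤ dist (f x) (f y) ∧ dist (f x) (f y) ≤ b * dist x y := by
  obtain rfl : ρ = fun x y => ‖canonicalMap μ x - canonicalMap μ y‖ :=
    funext₂ fun x y => (hρ x y).trans (norm_canonicalMap_sub μ x y).symm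
  classical
  refine exists_biLipschitz_euclidean_of_eventually ?_
  rintro ⟨x, y⟩
  rcases eq_or_ne x y with rfl | hxy
  · by_cases hx : μ {x} = 0
    · obtain ⟨F, c, hc, hF⟩ := exists_finset_lower_bound_near μ hx hℓ hlow
      refine ⟨F.image fun w x => ‖canonicalMap μ x - canonicalMap μ w‖, ?_, c, hc,
        hF.mono fun q hq hne => ?_⟩
      · simp only [Finset.forall_mem_image]
        intro w _
        simp only [← dist_eq_norm]
        exact ⟨_, (LipschitzWith.dist_left _).comp (lipschitzWith_canonicalMap μ)⟩
      · obtain ⟨w, hw, h⟩ := hq hne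
        exact ⟨_, Finset.mem_image_of_mem _ hw, h⟩
    · refine ⟨∅, by simp, 1, one_pos, ?_⟩
      have hpure : 𝓝 x = pure x := by
        rw [← isOpen_singleton_iff_nhds_eq_pure, isOpen_singleton_iff_punctured_nhds]
        exact hatoms x hx
      rw [nhds_prod_eq, hpure, Filter.prod_pure_pure]
      simp
  · refine ⟨{fun z => dist z x}, ?_, 1 / 2, by norm_num, ?_⟩
    · simpa using ⟨1, LipschitzWith.dist_left x⟩
    · exact (eventually_lower_bound_dist_of_ne hxy).mono fun q hq _ =>
        ⟨_, Finset.mem_singleton_self _, hq⟩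
end

section
/- Let X be a compact subset of a real normed linear space B. Then there exist N ∈ ℕ and a bounded linear map F : B → ℝ^N whose restriction to X is bi-Lipschitz if and only if X is weakly spherically compact, i.e. 0 does not belong to the closure of U(X) = {(x − y)/‖x − y‖ : x, y ∈ X, x ≠ y} in the weak topology of B. -/
/-- A vector of `ℝ^N` of norm at least `a > 0` has a coordinate of absolute value at least
`a / (N + 1)`. -/
theorem EuclideanSpace.exists_div_le_norm_apply {N : ℕ} {a : ℝ} (ha : 0 < a)
    {v : EuclideanSpace ℝ (Fin N)} (hv : a ≤ ‖v‖) : ∃ i, a / (N + 1) ≤ ‖v i‖ := by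
  by_contra! hlt
  have hsum : ‖v‖ ^ 2 ≤ N * (a / (N + 1)) ^ 2 := by
    rw [EuclideanSpace.norm_sq_eq]
    calc ∑ i, ‖v i‖ ^ 2 ≤ ∑ _i : Fin N, (a / (N + 1)) ^ 2 := by
          gcongr with i
          exact (hlt i).le
      _ = N * (a / (N + 1)) ^ 2 := by simp
  have hsq : a ^ 2 ≤ ‖v‖ ^ 2 := by gcongr
  have hmul : a ^ 2 = (N + 1) ^ 2 * (a / (N + 1)) ^ 2 := by field_simp
  have hpos : 0 < (a / (N + 1)) ^ 2 := by positivity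
  nlinarith [mul_nonneg (sq_nonneg (N : ℝ)) hpos.le,
    mul_nonneg (Nat.cast_nonneg (α := ℝ) N) hpos.le]

open Topology in
/-- `0` lies outside the weak closure of a set if and only if finitely many continuous functionals
separate it uniformly from the points of the set. -/
theorem zero_notMem_closure_toWeakSpace_image_iff
    {B : Type*} [NormedAddCommGroup B] [NormedSpace ℝ B] (U : Set B) :
    (0 : WeakSpace ℝ B) ∉ closure (toWeakSpace ℝ B '' U) ↔
      ∃ (s : Finset (StrongDual ℝ B)) (ε : ℝ), 0 < ε ∧ ∀ u ∈ U, ∃ f ∈ s, ε ≤ ‖f u‖ := by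
  have hb : (𝓝 (0 : WeakSpace ℝ B)).HasBasis
      (topDualPairing ℝ B).flip.toSeminormFamily.basisSets _root_.id :=
    (topDualPairing ℝ B).flip.hasBasis_weakBilin
  rw [mem_closure_iff_nhds_basis hb]
  push Not
  constructor
  · rintro ⟨V, hV, hVU⟩
    obtain ⟨s, r, hr, rfl⟩ := (SeminormFamily.basisSets_iff _).1 hV
    refine ⟨s, r, hr, fun u hu => ?_⟩
    by_contra! hlt
    exact hVU _ ⟨u, hu, rfl⟩ ((Seminorm.mem_ball_zero _).2 (Seminorm.finset_sup_apply_lt hr hlt))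
  · rintro ⟨s, ε, hε, h⟩
    refine ⟨_, SeminormFamily.basisSets_mem _ s hε, ?_⟩
    rintro _ ⟨u, hu, rfl⟩ hmem
    obtain ⟨f, hf, hfu⟩ := h u hu
    have hlt : s.sup (topDualPairing ℝ B).flip.toSeminormFamily u < ε :=
      (Seminorm.mem_ball_zero _).1 hmem
    exact hfu.not_gt ((Seminorm.le_finset_sup_apply hf).trans_lt hlt)


/-- **Lemma `wscfin`.** Let `X` be a compact subset of a real normed
linear space `B`.  There exist `N ∈ ℕ` and a bounded linear map `F : B → ℝ^N` whose
restriction to `X` is bi-Lipschitz if and only if `X` is weakly spherically compact,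
i.e. `0` does not belong to the weak closure of
`U(X) = {(x − y)/‖x − y‖ : x, y ∈ X, x ≠ y}`. -/
theorem finite_dim_biLipschitz_iff_weakly_spherically_compact
    {B : Type*} [NormedAddCommGroup B] [NormedSpace ℝ B]
    (X : Set B) (hX : IsCompact X) :
    (∃ (N : ℕ) (F : B →L[ℝ] EuclideanSpace ℝ (Fin N)) (a b : ℝ), 0 < a ∧ a ≤ b ∧
        ∀ x ∈ X, ∀ y ∈ X,
          a * ‖x - y‖ ≤ ‖F x - F y‖ ∧ ‖F x - F y‖ ≤ b * ‖x - y‖) ↔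
      (0 : WeakSpace ℝ B) ∉
        closure (toWeakSpace ℝ B ''
          {u : B | ∃ x ∈ X, ∃ y ∈ X, x ≠ y ∧ u = ‖x - y‖⁻¹ • (x - y)}) := by
  rw [zero_notMem_closure_toWeakSpace_image_iff]
  constructor
  · rintro ⟨N, F, a, b, ha, -, hF⟩
    classical
    let φ : Fin N → StrongDual ℝ B := fun i => (EuclideanSpace.proj i).comp F
    refine ⟨Finset.univ.image φ, a / (N + 1), by positivity, ?_⟩
    rintro _ ⟨x, hx, y, hy, hxy, rfl⟩
    have hpos : 0 < ‖x - y‖ := norm_pos_iff.2 (sub_ne_zero.2 hxy)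
    have hle : a ≤ ‖F (‖x - y‖⁻¹ • (x - y))‖ := by
      rw [map_smul, norm_smul, norm_inv, norm_norm, inv_mul_eq_div, le_div_iff₀ hpos, map_sub]
      exact (hF x hx y hy).1
    obtain ⟨i, hi⟩ := EuclideanSpace.exists_div_le_norm_apply ha hle
    exact ⟨φ i, Finset.mem_image_of_mem φ (Finset.mem_univ i), hi⟩
  · rintro ⟨s, ε, hε, h⟩
    let e := s.equivFin.symm
    let F : B →L[ℝ] EuclideanSpace ℝ (Fin s.card) :=
      (EuclideanSpace.equiv (Fin s.card) ℝ).symm.toContinuousLinearMap.comp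
        (ContinuousLinearMap.pi fun i => (e i : StrongDual ℝ B))
    refine ⟨s.card, F, ε, ε + ‖F‖, hε, by simp, fun x hx y hy => ?_⟩
    rw [← map_sub]
    refine ⟨?_, (F.le_opNorm _).trans (by gcongr; linarith)⟩
    rcases eq_or_ne x y with rfl | hxy
    · simp
    have hpos : 0 < ‖x - y‖ := norm_pos_iff.2 (sub_ne_zero.2 hxy)
    obtain ⟨f, hf, hfu⟩ := h _ ⟨x, hx, y, hy, hxy, rfl⟩
    rw [map_smul, norm_smul, norm_inv, norm_norm, inv_mul_eq_div, le_div_iff₀ hpos] at hfu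
    have hcoord : F (x - y) (e.symm ⟨f, hf⟩) = f (x - y) := by
      simp [F]
    rw [← hcoord] at hfu
    exact hfu.trans (PiLp.norm_apply_le _ _)
end

section
/- Let X be a compact subset of a real Hilbert space H, endowed with the inherited metric ‖· − ·‖_H, and let μ be a finite Borel regular measure on X with closed support equal to X and 0 < μ(X) < ∞. If X is spherically compact (the set U(X) = {(x − y)/‖x − y‖_H : x, y ∈ X, x ≠ y} has compact closure in the norm topology of H), then the canonical map X → L²(μ), x ↦ (z ↦ ‖x − z‖_H), is bi-Lipschitz. -/
open MeasureTheory

open scoped RealInnerProductSpace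

/-- The difference of the squared distances to `z`, as an inner product. -/
lemma inner_sub_add_sub_two_smul_eq {H : Type*} [NormedAddCommGroup H] [InnerProductSpace ℝ H]
    (x y z : H) :
    ⟪x - y, x + y - (2 : ℝ) • z⟫ =
      (‖x - z‖ - ‖y - z‖) * (‖x - z‖ + ‖y - z‖) := by
  have h : (‖x - z‖ - ‖y - z‖) * (‖x - z‖ + ‖y - z‖) =
      ⟪x - z, x - z⟫ - ⟪y - z, y - z⟫ := by
    rw [real_inner_self_eq_norm_sq, real_inner_self_eq_norm_sq]
    ring
  rw [h]
  simp only [inner_sub_left, inner_sub_right, inner_add_right, inner_smul_right,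
    real_inner_comm x y, real_inner_comm x z, real_inner_comm y z]
  ring

/-- A continuous function on a compact space whose square integral against a finite measure
of full support vanishes is identically zero. -/
lemma Continuous.eq_zero_of_integral_sq_eq_zero {X : Type*} [TopologicalSpace X] [CompactSpace X]
    [MeasurableSpace X] [BorelSpace X] {μ : Measure X} [IsFiniteMeasure μ] [μ.IsOpenPosMeasure]
    {f : X → ℝ} (hf : Continuous f) (h : ∫ z, f z ^ 2 ∂μ = 0) : f = 0 := by
  have hint : Integrable (fun z => f z ^ 2) μ :=
    (hf.pow 2).integrable_of_hasCompactSupport (HasCompactSupport.of_compactSpace _)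
  have h0 := (integral_eq_zero_iff_of_nonneg (fun z => sq_nonneg (f z)) hint).1 h
  have h1 := ((hf.pow 2).ae_eq_iff_eq μ continuous_const).1 h0
  ext z
  exact pow_eq_zero_iff two_ne_zero |>.1 (congrFun h1 z)

/-- If the directions of a compact set `X` have compact closure, the mean square over `X` of
`⟪u, x + y - 2 z⟫` is bounded away from zero for directions `u` and points `x y`. -/
lemma exists_pos_le_integral_inner_sq
    {H : Type*} [NormedAddCommGroup H] [InnerProductSpace ℝ H]
    [MeasurableSpace H] [BorelSpace H]
    {X : Set H} (hX : IsCompact X)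
    (μ : Measure X) [IsFiniteMeasure μ] [μ.IsOpenPosMeasure]
    (hsc : IsCompact
      (closure {u : H | ∃ x ∈ X, ∃ y ∈ X, x ≠ y ∧ u = ‖x - y‖⁻¹ • (x - y)})) :
    ∃ c : ℝ, 0 < c ∧ ∀ x ∈ X, ∀ y ∈ X, x ≠ y →
      c ≤ ∫ z : X, ⟪‖x - y‖⁻¹ • (x - y), x + y - (2 : ℝ) • (z : H)⟫ ^ 2 ∂μ := by
  set U : Set H := {u : H | ∃ x ∈ X, ∃ y ∈ X, x ≠ y ∧ u = ‖x - y‖⁻¹ • (x - y)} with hU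
  have : CompactSpace X := isCompact_iff_compactSpace.1 hX
  have : CompactSpace (closure U ×ˢ X ×ˢ X : Set (H × H × H)) :=
    isCompact_iff_compactSpace.1 (hsc.prod (hX.prod hX))
  have hcont : Continuous fun p : (closure U ×ˢ X ×ˢ X : Set (H × H × H)) =>
      ∫ z : X, ⟪p.1.1, p.1.2.1 + p.1.2.2 - (2 : ℝ) • (z : H)⟫ ^ 2 ∂μ := by
    have h := continuous_parametric_integral_of_continuous (μ := μ) (s := Set.univ)
      (f := fun (p : (closure U ×ˢ X ×ˢ X : Set (H × H × H))) (z : X) =>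
        ⟪p.1.1, p.1.2.1 + p.1.2.2 - (2 : ℝ) • (z : H)⟫ ^ 2)
      (by fun_prop) isCompact_univ
    simpa using h
  have hpos : ∀ p ∈ (Set.univ : Set (closure U ×ˢ X ×ˢ X : Set (H × H × H))),
      0 < ∫ z : X, ⟪p.1.1, p.1.2.1 + p.1.2.2 - (2 : ℝ) • (z : H)⟫ ^ 2 ∂μ := by
    rintro ⟨⟨u, x, y⟩, hu, -, -⟩ -
    refine (integral_nonneg fun z => sq_nonneg _).lt_of_ne' fun h => ?_
    have hz := Continuous.eq_zero_of_integral_sq_eq_zero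
      (f := fun z : X => ⟪u, x + y - (2 : ℝ) • (z : H)⟫) (by fun_prop) h
    have hnorm : ‖u‖ = 1 := by
      refine closure_minimal (t := {v : H | ‖v‖ = 1}) ?_
        (isClosed_eq continuous_norm continuous_const) hu
      rintro v ⟨a, -, b, -, hab, rfl⟩
      exact norm_smul_inv_norm (𝕜 := ℝ) (sub_ne_zero.2 hab)
    have horth : ⟪u, u⟫ = 0 := by
      refine closure_minimal (t := {v : H | ⟪u, v⟫ = 0}) ?_
        (isClosed_eq (by fun_prop) continuous_const) hu
      rintro v ⟨a, ha, b, hb, -, rfl⟩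
      have h1 := congrFun hz ⟨a, ha⟩
      have h2 := congrFun hz ⟨b, hb⟩
      simp only [inner_sub_right, inner_smul_right, Pi.zero_apply] at h1 h2
      have h3 : ⟪u, a⟫ - ⟪u, b⟫ = 0 := by linarith
      simp [inner_smul_right, inner_sub_right, h3]
    rw [real_inner_self_eq_norm_sq, hnorm] at horth
    norm_num at horth
  obtain ⟨c, hc, hle⟩ := isCompact_univ.exists_forall_le' hcont.continuousOn hpos
  exact ⟨c, hc, fun x hx y hy hxy => hle
    ⟨(‖x - y‖⁻¹ • (x - y), x, y), subset_closure ⟨x, hx, y, hy, hxy, rfl⟩, hx, hy⟩ trivial⟩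

/-- **Theorem `hilwsc` (1).** Let `X` be a compact subset of a real
Hilbert space `H` with the inherited metric, and let `μ` be a finite Borel regular
measure on `X` with closed support `X` and `0 < μ(X) < ∞`.  If `X` is spherically
compact, then the canonical map `X → L²(μ)`, `x ↦ (z ↦ ‖x − z‖)`, is bi-Lipschitz. -/
theorem canonical_map_biLipschitz_of_spherically_compact
    {H : Type*} [NormedAddCommGroup H] [InnerProductSpace ℝ H] [CompleteSpace H]
    [MeasurableSpace H] [BorelSpace H]
    (X : Set H) (hX : IsCompact X)
    (μ : Measure X) [IsFiniteMeasure μ] [μ.Regular] [μ.IsOpenPosMeasure]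
    (hμ : μ Set.univ ≠ 0)
    (hsc : IsCompact
      (closure {u : H | ∃ x ∈ X, ∃ y ∈ X, x ≠ y ∧ u = ‖x - y‖⁻¹ • (x - y)})) :
    ∃ a b : ℝ, 0 < a ∧ a ≤ b ∧ ∀ x y : X,
      a * ‖(x : H) - (y : H)‖ ≤
          Real.sqrt (∫ z : X, (‖(x : H) - (z : H)‖ - ‖(y : H) - (z : H)‖) ^ 2 ∂μ) ∧
      Real.sqrt (∫ z : X, (‖(x : H) - (z : H)‖ - ‖(y : H) - (z : H)‖) ^ 2 ∂μ) ≤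
          b * ‖(x : H) - (y : H)‖ := by
  have : CompactSpace X := isCompact_iff_compactSpace.1 hX
  obtain ⟨c, hc, hle⟩ := exists_pos_le_integral_inner_sq hX μ hsc
  obtain ⟨D, hD, hbound⟩ : ∃ D : ℝ, 0 < D ∧ ∀ x ∈ X, ∀ z ∈ X, ‖x - z‖ ≤ D := by
    refine ⟨Metric.diam X + 1, by positivity, fun x hx z hz => ?_⟩
    rw [← dist_eq_norm]
    linarith [Metric.dist_le_diam_of_mem hX.isBounded hx hz]
  have hint : ∀ f : X → ℝ, Continuous f → Integrable f μ := fun f hf =>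
    hf.integrable_of_hasCompactSupport (HasCompactSupport.of_compactSpace _)
  refine ⟨√c / (2 * D), max (√c / (2 * D)) √(μ.real Set.univ), by positivity,
    le_max_left _ _, fun x y => ⟨?_, ?_⟩⟩
  · rcases eq_or_ne (x : H) y with hxy | hxy
    · simp [hxy]
    have hn : 0 < ‖(x : H) - y‖ := norm_pos_iff.2 (sub_ne_zero.2 hxy)
    apply Real.le_sqrt_of_sq_le
    have hmono : ∫ z : X, ⟪‖(x : H) - y‖⁻¹ • ((x : H) - y),
          (x : H) + y - (2 : ℝ) • (z : H)⟫ ^ 2 ∂μ ≤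
        ∫ z : X, (‖(x : H) - y‖⁻¹ * (2 * D)) ^ 2 *
          (‖(x : H) - (z : H)‖ - ‖(y : H) - (z : H)‖) ^ 2 ∂μ := by
      refine integral_mono (hint _ (by fun_prop)) (hint _ (by fun_prop)) fun z => ?_
      have hs : (‖(x : H) - z‖ + ‖(y : H) - z‖) ^ 2 ≤ (2 * D) ^ 2 := by
        gcongr
        linarith [hbound x x.2 z z.2, hbound y y.2 z z.2]
      simp only [inner_smul_left, inner_sub_add_sub_two_smul_eq, mul_pow, conj_trivial] at hs ⊢
      calc _ = (‖(x : H) - y‖⁻¹ ^ 2 * (‖(x : H) - z‖ - ‖(y : H) - z‖) ^ 2) *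
            (‖(x : H) - z‖ + ‖(y : H) - z‖) ^ 2 := by ring
        _ ≤ (‖(x : H) - y‖⁻¹ ^ 2 * (‖(x : H) - z‖ - ‖(y : H) - z‖) ^ 2) *
            (2 ^ 2 * D ^ 2) := by gcongr
        _ = _ := by ring
    rw [integral_const_mul] at hmono
    have h := (hle x x.2 y y.2 hxy).trans hmono
    have hk : (√c / (2 * D) * ‖(x : H) - y‖) ^ 2 =
        c / (‖(x : H) - y‖⁻¹ * (2 * D)) ^ 2 := by
      rw [mul_pow, div_pow, Real.sq_sqrt hc.le]
      field_simp
    rw [hk, div_le_iff₀ (by positivity), mul_comm]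
    exact h
  · refine le_trans ?_ (mul_le_mul_of_nonneg_right (le_max_right _ _) (norm_nonneg _))
    rw [← Real.sqrt_sq (norm_nonneg ((x : H) - y)), ← Real.sqrt_mul measureReal_nonneg]
    apply Real.sqrt_le_sqrt
    rw [← smul_eq_mul, ← integral_const]
    refine integral_mono (hint _ (by fun_prop)) (hint _ (by fun_prop)) fun z => ?_
    refine sq_le_sq.2 ?_
    rw [abs_of_nonneg (norm_nonneg _)]
    simpa using abs_norm_sub_norm_le ((x : H) - z) ((y : H) - z)
end

section
/- Let X be a compact subset of a real Hilbert space H, endowed with the inherited metric ‖· − ·‖_H, and let μ be a finite Borel regular measure on X with closed support equal to X, 0 < μ(X) < ∞, all of whose atoms are isolated points of X. If the canonical map X → L²(μ), x ↦ (z ↦ ‖x − z‖_H), is bi-Lipschitz, then X is weakly spherically compact, i.e. 0 does not belong to the closure of U(X) = {(x − y)/‖x − y‖_H : x, y ∈ X, x ≠ y} in the weak topology of H. -/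
open MeasureTheory Filter
open scoped Topology

section SphericalDifferences

variable {H : Type*} [NormedAddCommGroup H] [InnerProductSpace ℝ H]

/-- If `0` is in the weak closure of `V`, then some sequence in `V` converges to `0` when tested
against every term of a given sequence of vectors. -/
theorem exists_seq_tendsto_inner_of_zero_mem_closure_toWeakSpace {V : Set H}
    (h : (0 : WeakSpace ℝ H) ∈ closure (toWeakSpace ℝ H '' V)) (w : ℕ → H) :
    ∃ u : ℕ → H, (∀ n, u n ∈ V) ∧ ∀ k, Tendsto (fun n => inner ℝ (w k) (u n)) atTop (𝓝 0) := by
  let Φ : WeakSpace ℝ H → ℕ → ℝ := fun v k => inner ℝ (w k) ((toWeakSpace ℝ H).symm v)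
  have hΦ : Continuous Φ := continuous_pi fun k =>
    WeakBilin.eval_continuous (topDualPairing ℝ H).flip (innerSL ℝ (w k))
  have h0 : Φ 0 ∈ closure (Φ '' (toWeakSpace ℝ H '' V)) :=
    image_closure_subset_closure_image hΦ ⟨0, h, rfl⟩
  obtain ⟨v, hv, hlim⟩ := mem_closure_iff_seq_limit.1 h0
  choose q hq hqv using hv
  choose u hu huq using hq
  refine ⟨u, hu, fun k => ?_⟩
  have hk := (tendsto_pi_nhds.1 hlim) k
  simpa [Φ, ← hqv, ← huq] using hk

/-- A bounded sequence that tends to `0` against a dense sequence of points of `X` also tends to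
`0` against every convergent sequence of points of `X`. -/
theorem tendsto_inner_zero_of_denseRange {X : Set H} {w : ℕ → X} (hw : DenseRange w)
    {u : ℕ → H} (hu : ∀ n, ‖u n‖ ≤ 1)
    (h : ∀ k, Tendsto (fun n => inner ℝ (w k : H) (u n)) atTop (𝓝 0))
    {x : ℕ → X} {x₀ : X} (hx : Tendsto x atTop (𝓝 x₀)) :
    Tendsto (fun n => inner ℝ (x n : H) (u n)) atTop (𝓝 0) := by
  rw [Metric.tendsto_atTop]
  intro ε hε
  obtain ⟨k, hk⟩ := hw.exists_dist_lt x₀ (show 0 < ε / 3 by positivity)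
  obtain ⟨N, hN⟩ := Metric.tendsto_atTop.1 hx (ε / 3) (by positivity)
  obtain ⟨M, hM⟩ := Metric.tendsto_atTop.1 (h k) (ε / 3) (by positivity)
  refine ⟨max N M, fun n hn => ?_⟩
  have h1 := hN n (le_of_max_le_left hn)
  have h2 := hM n (le_of_max_le_right hn)
  have h3 : ‖(x n : H) - w k‖ < ε / 3 + ε / 3 := by
    rw [← dist_eq_norm, ← Subtype.dist_eq]
    exact (dist_triangle _ x₀ _).trans_lt (add_lt_add h1 hk)
  have h4 : |inner ℝ ((x n : H) - w k) (u n)| ≤ ‖(x n : H) - w k‖ :=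
    (abs_real_inner_le_norm _ _).trans (mul_le_of_le_one_right (norm_nonneg _) (hu n))
  rw [inner_sub_left] at h4
  rw [Real.dist_eq, sub_zero] at h2 ⊢
  have := abs_add_le (inner ℝ (x n : H) (u n) - inner ℝ (w k : H) (u n)) (inner ℝ (w k : H) (u n))
  rw [sub_add_cancel] at this
  linarith

theorem norm_sub_norm_mul_norm_add_norm (p q : H) :
    (‖p‖ - ‖q‖) * (‖p‖ + ‖q‖) = inner ℝ (p + q) (p - q) := by
  rw [inner_add_left, inner_sub_right, inner_sub_right, real_inner_self_eq_norm_sq,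
    real_inner_self_eq_norm_sq, real_inner_comm p q]
  ring

theorem norm_sub_norm_div_norm_sub {x y z : H} (h : ‖x - z‖ + ‖y - z‖ ≠ 0) :
    (‖x - z‖ - ‖y - z‖) / ‖x - y‖ =
      inner ℝ ((x - z) + (y - z)) (‖x - y‖⁻¹ • (x - y)) / (‖x - z‖ + ‖y - z‖) := by
  have := norm_sub_norm_mul_norm_add_norm (x - z) (y - z)
  rw [sub_sub_sub_cancel_right] at this
  rw [inner_smul_right, ← this, eq_div_iff h]
  ring

theorem sq_norm_sub_norm_div_norm_sub_le_one {E : Type*} [NormedAddCommGroup E] (x y z : E) :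
    ((‖x - z‖ - ‖y - z‖) / ‖x - y‖) ^ 2 ≤ 1 := by
  rw [sq_le_one_iff_abs_le_one, abs_div, abs_norm]
  refine div_le_one_of_le₀ ?_ (norm_nonneg _)
  simpa using abs_norm_sub_norm_le (x - z) (y - z)

/-- If the directions of `x n - y n` tend to `0` against all convergent sequences of `X` and both
sequences tend to `x₀`, then the normalized differences of the distance functions tend to `0`
away from `x₀`. -/
theorem tendsto_sq_norm_sub_norm_div_norm_sub {X : Set H} {x y : ℕ → X} {x₀ z : X}
    (hz : z ≠ x₀) (hx : Tendsto x atTop (𝓝 x₀)) (hy : Tendsto y atTop (𝓝 x₀))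
    (h : ∀ (w : ℕ → X) (w₀ : X), Tendsto w atTop (𝓝 w₀) → Tendsto (fun n =>
      inner ℝ (w n : H) (‖(x n : H) - y n‖⁻¹ • ((x n : H) - y n))) atTop (𝓝 0)) :
    Tendsto (fun n => ((‖(x n : H) - z‖ - ‖(y n : H) - z‖) / ‖(x n : H) - y n‖) ^ 2)
      atTop (𝓝 0) := by
  have hxH := (continuous_subtype_val.tendsto x₀).comp hx
  have hyH := (continuous_subtype_val.tendsto x₀).comp hy
  have hs : Tendsto (fun n => ‖(x n : H) - z‖ + ‖(y n : H) - z‖) atTop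
      (𝓝 (‖(x₀ : H) - z‖ + ‖(x₀ : H) - z‖)) :=
    (hxH.sub_const _).norm.add (hyH.sub_const _).norm
  have hpos : 0 < ‖(x₀ : H) - z‖ :=
    norm_pos_iff.2 (sub_ne_zero.2 fun he => hz (Subtype.ext he.symm))
  have hs0 : ‖(x₀ : H) - z‖ + ‖(x₀ : H) - z‖ ≠ 0 := by positivity
  have hzc := h _ z tendsto_const_nhds
  have hnum := ((h x x₀ hx).sub hzc).add ((h y x₀ hy).sub hzc)
  have hquot := (hnum.div hs hs0).pow 2
  simp only [sub_zero, add_zero, zero_div, ne_eq, OfNat.ofNat_ne_zero, not_false_eq_true,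
    zero_pow] at hquot
  refine hquot.congr' ?_
  filter_upwards [hs.eventually_ne hs0] with n hn
  rw [norm_sub_norm_div_norm_sub hn]
  simp only [inner_add_left, inner_sub_left, Pi.div_apply]

end SphericalDifferences

/-- **Theorem `hilwsc` (2).** Let `X` be a compact subset of a real
Hilbert space `H` with the inherited metric, and let `μ` be a finite Borel regular
measure on `X` with closed support `X`, `0 < μ(X) < ∞`, all of whose atoms are isolated
points of `X`.  If the canonical map `X → L²(μ)` is bi-Lipschitz, then `X` is weakly
spherically compact: `0` is not in the weak closure of `U(X)`. -/
theorem weakly_spherically_compact_of_canonical_map_biLipschitz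
    {H : Type*} [NormedAddCommGroup H] [InnerProductSpace ℝ H] [CompleteSpace H]
    [MeasurableSpace H] [BorelSpace H]
    (X : Set H) (hX : IsCompact X)
    (μ : Measure X) [IsFiniteMeasure μ] [μ.Regular] [μ.IsOpenPosMeasure]
    (hμ : μ Set.univ ≠ 0)
    (hatoms : ∀ x : X, μ {x} ≠ 0 → 𝓝[≠] x = ⊥)
    (a b : ℝ) (ha : 0 < a) (hab : a ≤ b)
    (hbl : ∀ x y : X,
      a * ‖(x : H) - (y : H)‖ ≤
          Real.sqrt (∫ z : X, (‖(x : H) - (z : H)‖ - ‖(y : H) - (z : H)‖) ^ 2 ∂μ) ∧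
      Real.sqrt (∫ z : X, (‖(x : H) - (z : H)‖ - ‖(y : H) - (z : H)‖) ^ 2 ∂μ) ≤
          b * ‖(x : H) - (y : H)‖) :
    (0 : WeakSpace ℝ H) ∉
      closure (toWeakSpace ℝ H ''
        {u : H | ∃ x ∈ X, ∃ y ∈ X, x ≠ y ∧ u = ‖x - y‖⁻¹ • (x - y)}) := by
  intro hmem
  have : CompactSpace X := isCompact_iff_compactSpace.1 hX
  have hXne : Nonempty X := by
    obtain ⟨_, u, ⟨x, hx, -⟩, -⟩ := closure_nonempty_iff.1 ⟨_, hmem⟩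
    exact ⟨⟨x, hx⟩⟩
  obtain ⟨u, hu, hlim⟩ := exists_seq_tendsto_inner_of_zero_mem_closure_toWeakSpace hmem
    (fun k => (TopologicalSpace.denseSeq X k : H))
  choose x hx y hy hxy hux using hu
  have hu1 (n : ℕ) : ‖u n‖ ≤ 1 := by
    rw [hux, norm_smul, norm_inv, norm_norm]
    exact inv_mul_le_one
  obtain ⟨⟨x₀, y₀⟩, φ, hφ, hconv⟩ := CompactSpace.tendsto_subseq
    (fun n => ((⟨x n, hx n⟩, ⟨y n, hy n⟩) : X × X))
  let p : ℕ → X := fun n => ⟨x (φ n), hx _⟩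
  let q : ℕ → X := fun n => ⟨y (φ n), hy _⟩
  have hp : Tendsto p atTop (𝓝 x₀) := (continuous_fst.tendsto _).comp hconv
  have hq : Tendsto q atTop (𝓝 y₀) := (continuous_snd.tendsto _).comp hconv
  have hpq (n : ℕ) : 0 < ‖(p n : H) - q n‖ := norm_pos_iff.2 (sub_ne_zero.2 (hxy (φ n)))
  have htest (w : ℕ → X) (w₀ : X) (hw : Tendsto w atTop (𝓝 w₀)) : Tendsto (fun n =>
      inner ℝ (w n : H) (‖(p n : H) - q n‖⁻¹ • ((p n : H) - q n))) atTop (𝓝 0) := by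
    simp only [p, q, ← hux]
    exact tendsto_inner_zero_of_denseRange (TopologicalSpace.denseRange_denseSeq X)
      (fun n => hu1 (φ n)) (fun k => (hlim k).comp hφ.tendsto_atTop) hw
  have hxy₀ : y₀ = x₀ := by
    have h0 : Tendsto (fun n => ‖(p n : H) - q n‖) atTop (𝓝 0) := by
      have := (htest p x₀ hp).sub (htest q y₀ hq)
      rw [sub_zero] at this
      refine this.congr fun n => ?_
      rw [← inner_sub_left, inner_smul_right, real_inner_self_eq_norm_mul_norm,
        inv_mul_cancel_left₀ (hpq n).ne']
    have h1 : Tendsto (fun n => ‖(p n : H) - q n‖) atTop (𝓝 ‖(x₀ : H) - y₀‖) :=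
      (((continuous_subtype_val.tendsto x₀).comp hp).sub
        ((continuous_subtype_val.tendsto y₀).comp hq)).norm
    exact (Subtype.ext (sub_eq_zero.1 (norm_eq_zero.1 (tendsto_nhds_unique h1 h0)))).symm
  subst hxy₀
  have hnull : μ {y₀} = 0 := by
    by_contra hne
    have hopen : ({y₀} : Set X) ∈ 𝓝 y₀ := (isOpen_singleton_iff_punctured_nhds y₀).2
      (hatoms y₀ hne) |>.mem_nhds rfl
    obtain ⟨n, hn, hn'⟩ := ((hp.eventually hopen).and (hq.eventually hopen)).exists
    have : p n = q n := Eq.trans hn (Eq.symm hn')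
    simpa [this] using hpq n
  have hint : Tendsto (fun n => ∫ z : X,
      ((‖(p n : H) - z‖ - ‖(q n : H) - z‖) / ‖(p n : H) - q n‖) ^ 2 ∂μ) atTop (𝓝 0) := by
    have := tendsto_integral_of_dominated_convergence (μ := μ) (f := fun _ : X => (0 : ℝ))
      (F := fun n (z : X) => ((‖(p n : H) - z‖ - ‖(q n : H) - z‖) / ‖(p n : H) - q n‖) ^ 2)
      (fun _ => 1) (fun n => (by fun_prop : Continuous _).aestronglyMeasurable)
      (integrable_const 1)
      (fun n => ae_of_all _ fun z => by
        rw [Real.norm_of_nonneg (sq_nonneg _)]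
        exact sq_norm_sub_norm_div_norm_sub_le_one _ _ _)
      (by
        filter_upwards [compl_mem_ae_iff.2 hnull] with z hz
        exact tendsto_sq_norm_sub_norm_div_norm_sub hz hp hq htest)
    simpa using this
  have hle : a ^ 2 ≤ 0 := by
    refine ge_of_tendsto' hint fun n => ?_
    have h1 := (Real.le_sqrt' (mul_pos ha (hpq n))).1 (hbl (p n) (q n)).1
    simp only [div_pow]
    rw [integral_div, le_div_iff₀ (pow_pos (hpq n) 2), ← mul_pow]
    exact h1
  exact absurd hle (not_le.2 (pow_pos ha 2))
end

section
/- Let (X, d, μ) be a compact metric-measure space. Then μ separates points uniformly with respect to d (there exist ε > 0 and c > 0 such that μ({z ∈ X : |d(x, z) − d(y, z)| ≥ ε·d(x, y)}) ≥ c for all x, y ∈ X) if and only if the canonical map ι_d : (X, d) → L²(μ) is bi-Lipschitz, i.e. there exists ℓ > 0 with ℓ·d(x, y) ≤ ‖ι_d(x) − ι_d(y)‖₂ for all x, y ∈ X (the upper Lipschitz bound ‖ι_d(x) − ι_d(y)‖₂ ≤ μ(X)^{1/2}·d(x, y) holding automatically). -/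
open MeasureTheory

section CanonicalMap

variable {X : Type*} [MetricSpace X]

lemma sq_dist_sub_dist_le (x y z : X) : (dist x z - dist y z) ^ 2 ≤ dist x y ^ 2 :=
  sq_le_sq' (neg_le_of_abs_le (abs_dist_sub_le x y z)) (le_of_abs_le (abs_dist_sub_le x y z))

variable [CompactSpace X] [MeasurableSpace X] [BorelSpace X] (μ : Measure X) [IsFiniteMeasure μ]

lemma integrable_sq_dist_sub_dist (x y : X) :
    Integrable (fun z => (dist x z - dist y z) ^ 2) μ :=
  Continuous.integrable_of_hasCompactSupport (by fun_prop) (HasCompactSupport.of_compactSpace _)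

lemma integral_sq_dist_sub_dist_le (x y : X) :
    ∫ z, (dist x z - dist y z) ^ 2 ∂μ ≤ μ.real Set.univ * dist x y ^ 2 := by
  calc ∫ z, (dist x z - dist y z) ^ 2 ∂μ ≤ ∫ _, dist x y ^ 2 ∂μ :=
        integral_mono (integrable_sq_dist_sub_dist μ x y) (integrable_const _)
          (sq_dist_sub_dist_le x y)
    _ = μ.real Set.univ * dist x y ^ 2 := by simp

/-- Chebyshev's inequality for the difference of two distance functions. -/
lemma sq_mul_measureReal_le_integral {ε : ℝ} (hε : 0 ≤ ε) (x y : X) :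
    (ε * dist x y) ^ 2 * μ.real {z : X | ε * dist x y ≤ |dist x z - dist y z|} ≤
      ∫ z, (dist x z - dist y z) ^ 2 ∂μ := by
  have h := mul_meas_ge_le_integral_of_nonneg (μ := μ)
    (Filter.Eventually.of_forall fun z => sq_nonneg (dist x z - dist y z))
    (integrable_sq_dist_sub_dist μ x y) ((ε * dist x y) ^ 2)
  have hset : {z : X | (ε * dist x y) ^ 2 ≤ (dist x z - dist y z) ^ 2} =
      {z : X | ε * dist x y ≤ |dist x z - dist y z|} := by
    ext z
    simp only [Set.mem_ofPred_eq]
    rw [sq_le_sq, abs_of_nonneg (mul_nonneg hε dist_nonneg)]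
  rwa [hset] at h

/-- The `L²` distance is controlled by the mass of the points separating `x` from `y`. -/
lemma integral_sq_dist_sub_dist_le_add (ε : ℝ) (x y : X) :
    ∫ z, (dist x z - dist y z) ^ 2 ∂μ ≤
      (ε ^ 2 * μ.real Set.univ +
        μ.real {z : X | ε * dist x y ≤ |dist x z - dist y z|}) * dist x y ^ 2 := by
  set E := {z : X | ε * dist x y ≤ |dist x z - dist y z|}
  have hE : MeasurableSet E := (isClosed_le (by fun_prop) (by fun_prop)).measurableSet
  have hi : Integrable (E.indicator fun _ => dist x y ^ 2) μ := (integrable_const _).indicator hE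
  calc ∫ z, (dist x z - dist y z) ^ 2 ∂μ
      ≤ ∫ z, ((ε * dist x y) ^ 2 + E.indicator (fun _ => dist x y ^ 2) z) ∂μ := by
        refine integral_mono (integrable_sq_dist_sub_dist μ x y)
          ((integrable_const _).add hi) fun z => ?_
        by_cases hz : z ∈ E
        · simpa [hz] using (sq_dist_sub_dist_le x y z).trans
            (le_add_of_nonneg_left (sq_nonneg (ε * dist x y)))
        · have hlt : |dist x z - dist y z| < ε * dist x y := not_le.mp hz
          simpa [hz] using sq_le_sq' (neg_lt_of_abs_lt hlt).le (lt_of_abs_lt hlt).le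
    _ = (ε ^ 2 * μ.real Set.univ + μ.real E) * dist x y ^ 2 := by
        rw [integral_add (integrable_const _) hi, integral_const, integral_indicator_const _ hE]
        simp only [smul_eq_mul]
        ring

end CanonicalMap

/-- **Theorem `bL-sep`.** Let `(X, d, μ)` be a compact metric-measure
space.  Then `μ` separates points uniformly with respect to `d` if and only if the
canonical map `ι_d : (X, d) → L²(μ)` is bi-Lipschitz, i.e. lower Lipschitz (the upper
bound `‖ι_d x − ι_d y‖₂ ≤ μ(X)^{1/2}·d(x,y)` holding automatically). -/
theorem uniform_separation_iff_canonical_map_biLipschitz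
    {X : Type*} [MetricSpace X] [CompactSpace X]
    [MeasurableSpace X] [BorelSpace X]
    (μ : Measure X) [IsFiniteMeasure μ] [μ.Regular] [μ.IsOpenPosMeasure] :
    ((∃ ε c : ℝ, 0 < ε ∧ 0 < c ∧ ∀ x y : X,
        c ≤ (μ {z : X | ε * dist x y ≤ |dist x z - dist y z|}).toReal) ↔
      (∃ ℓ : ℝ, 0 < ℓ ∧ ∀ x y : X,
        ℓ * dist x y ≤ Real.sqrt (∫ z, (dist x z - dist y z) ^ 2 ∂μ))) ∧
    (∀ x y : X,
      Real.sqrt (∫ z, (dist x z - dist y z) ^ 2 ∂μ) ≤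
        Real.sqrt ((μ Set.univ).toReal) * dist x y) := by
  refine ⟨⟨?_, ?_⟩, fun x y => ?_⟩
  · rintro ⟨ε, c, hε, hc, h⟩
    refine ⟨ε * √c, by positivity, fun x y => Real.le_sqrt_of_sq_le ?_⟩
    calc (ε * √c * dist x y) ^ 2 = (ε * dist x y) ^ 2 * c := by
          rw [mul_right_comm, mul_pow, Real.sq_sqrt hc.le]
      _ ≤ _ := mul_le_mul_of_nonneg_left (h x y) (sq_nonneg _)
      _ ≤ _ := sq_mul_measureReal_le_integral μ hε.le x y
  · rintro ⟨ℓ, hℓ, h⟩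
    rcases isEmpty_or_nonempty X with hX | hX
    · exact ⟨1, 1, one_pos, one_pos, fun x => hX.elim x⟩
    set M := μ.real Set.univ
    have hM : 0 < M := ENNReal.toReal_pos (isOpen_univ.measure_pos μ Set.univ_nonempty).ne'
      (measure_ne_top μ _)
    have hε : √(ℓ ^ 2 / (2 * M)) ^ 2 * M = ℓ ^ 2 / 2 := by
      rw [Real.sq_sqrt (by positivity)]
      field_simp
    refine ⟨√(ℓ ^ 2 / (2 * M)), min (ℓ ^ 2 / 2) M, by positivity, by positivity, fun x y => ?_⟩
    rcases eq_or_ne x y with rfl | hxy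
    · simp [M, Measure.real]
    · refine (min_le_left _ _).trans ?_
      have hd : 0 < dist x y := dist_pos.mpr hxy
      have hsq : (ℓ * dist x y) ^ 2 ≤ ∫ z, (dist x z - dist y z) ^ 2 ∂μ :=
        (Real.le_sqrt' (by positivity)).mp (h x y)
      have hle := hsq.trans (integral_sq_dist_sub_dist_le_add μ (√(ℓ ^ 2 / (2 * M))) x y)
      rw [mul_pow, hε] at hle
      have := le_of_mul_le_mul_right hle (by positivity)
      rw [← measureReal_def]
      linarith
  · rw [← Real.sqrt_sq (dist_nonneg (x := x) (y := y)), ← Real.sqrt_mul ENNReal.toReal_nonneg]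
    exact Real.sqrt_le_sqrt (integral_sq_dist_sub_dist_le μ x y)
end

section
/- Let (X, d, μ) be a compact metric-measure space, let Δ(d)(x, y) = ∫_X d(x, z)·d(y, z) dμ(z), and let ι_{Δ(d)} : X → L²(μ) be the map sending x to the function y ↦ Δ(d)(x, y). If there exists ℓ > 0 such that ℓ·d(x, y) ≤ ‖ι_{Δ(d)}(x) − ι_{Δ(d)}(y)‖₂ for all x, y ∈ X, then there exist N ∈ ℕ and a bi-Lipschitz embedding of (X, d) into ℝ^N. -/
open MeasureTheory

/-- The mixed second difference of `Δ` is controlled by the product of the two distances. -/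
theorem abs_integral_dist_mul_dist_sub_le {X : Type*} [MetricSpace X] [CompactSpace X]
    [MeasurableSpace X] [BorelSpace X] (μ : Measure X) [IsFiniteMeasure μ] (x y v w : X) :
    |((∫ z, dist x z * dist w z ∂μ) - ∫ z, dist y z * dist w z ∂μ) -
        ((∫ z, dist x z * dist v z ∂μ) - ∫ z, dist y z * dist v z ∂μ)| ≤
      dist x y * dist w v * μ.real Set.univ := by
  have hint (p q : X) : Integrable (fun z => dist p z * dist q z) μ :=
    Continuous.integrable_of_hasCompactSupport (by fun_prop) (HasCompactSupport.of_compactSpace _)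
  rw [← integral_sub (hint x w) (hint y w), ← integral_sub (hint x v) (hint y v),
    ← integral_sub (by exact (hint x w).sub (hint y w)) (by exact (hint x v).sub (hint y v)),
    ← Real.norm_eq_abs]
  refine norm_integral_le_of_norm_le_const (Filter.Eventually.of_forall fun z => ?_)
  have h : dist x z * dist w z - dist y z * dist w z - (dist x z * dist v z - dist y z * dist v z)
      = (dist x z - dist y z) * (dist w z - dist v z) := by ring
  rw [h, Real.norm_eq_abs, abs_mul]
  exact mul_le_mul (abs_dist_sub_le x y z) (abs_dist_sub_le w v z) (abs_nonneg _) dist_nonneg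

/-- For fixed `w`, the function `Δ(·, w)` is Lipschitz. -/
theorem abs_integral_dist_mul_dist_sub_le_diam {X : Type*} [MetricSpace X] [CompactSpace X]
    [MeasurableSpace X] [BorelSpace X] (μ : Measure X) [IsFiniteMeasure μ] (x y w : X) :
    |(∫ z, dist x z * dist w z ∂μ) - ∫ z, dist y z * dist w z ∂μ| ≤
      dist x y * Metric.diam (Set.univ : Set X) * μ.real Set.univ := by
  have hint (p q : X) : Integrable (fun z => dist p z * dist q z) μ :=
    Continuous.integrable_of_hasCompactSupport (by fun_prop) (HasCompactSupport.of_compactSpace _)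
  rw [← integral_sub (hint x w) (hint y w), ← Real.norm_eq_abs]
  refine norm_integral_le_of_norm_le_const (Filter.Eventually.of_forall fun z => ?_)
  rw [← sub_mul, Real.norm_eq_abs, abs_mul, abs_of_nonneg (dist_nonneg (x := w))]
  exact mul_le_mul (abs_dist_sub_le x y z) (Metric.dist_le_diam_of_mem
    isCompact_univ.isBounded trivial trivial) dist_nonneg dist_nonneg

/-- A pointwise bound on a function bounds its `L²` norm on a finite measure space. -/
theorem sqrt_integral_sq_le_of_abs_le {X : Type*} [MeasurableSpace X] (μ : Measure X)
    [IsFiniteMeasure μ] {g : X → ℝ} {K : ℝ} (hK : 0 ≤ K) (hg : ∀ w, |g w| ≤ K) :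
    Real.sqrt (∫ w, g w ^ 2 ∂μ) ≤ K * Real.sqrt (μ.real Set.univ) := by
  have h : ∫ w, g w ^ 2 ∂μ ≤ K ^ 2 * μ.real Set.univ := by
    refine (Real.le_norm_self _).trans (norm_integral_le_of_norm_le_const
      (Filter.Eventually.of_forall fun w => ?_))
    rw [norm_pow, Real.norm_eq_abs]
    exact pow_le_pow_left₀ (abs_nonneg _) (hg w) 2
  calc Real.sqrt (∫ w, g w ^ 2 ∂μ) ≤ Real.sqrt (K ^ 2 * μ.real Set.univ) := Real.sqrt_le_sqrt h
    _ = K * Real.sqrt (μ.real Set.univ) := by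
      rw [Real.sqrt_mul (sq_nonneg K), Real.sqrt_sq hK]

/-- A coordinatewise bound on the distance in Euclidean space. -/
theorem EuclideanSpace.dist_le_sqrt_mul_of_forall_dist_le {ι : Type*} [Fintype ι]
    {p q : EuclideanSpace ℝ ι} {K : ℝ} (hK : 0 ≤ K) (h : ∀ i, dist (p i) (q i) ≤ K) :
    dist p q ≤ Real.sqrt (Fintype.card ι) * K := by
  rw [EuclideanSpace.dist_eq]
  calc Real.sqrt (∑ i, dist (p i) (q i) ^ 2) ≤ Real.sqrt (∑ _i : ι, K ^ 2) :=
        Real.sqrt_le_sqrt (Finset.sum_le_sum fun i _ => pow_le_pow_left₀ dist_nonneg (h i) 2)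
    _ = Real.sqrt (Fintype.card ι) * K := by
      rw [Finset.sum_const, Finset.card_univ, nsmul_eq_mul, Real.sqrt_mul (Nat.cast_nonneg _),
        Real.sqrt_sq hK]

/-- **Theorem `d*d`.** Let `(X, d, μ)` be a compact metric-measure
space, `Δ(d)(x, y) = ∫ d(x,z) d(y,z) dμ(z)`, and `ι_{Δ(d)} : X → L²(μ)` the map
`x ↦ (y ↦ Δ(d)(x, y))`.  If `ι_{Δ(d)}` is lower Lipschitz, then `(X, d)` admits a
bi-Lipschitz embedding into some `ℝ^N`. -/
theorem biLipschitz_embedding_of_iota_Delta_lower_Lipschitz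
    {X : Type*} [MetricSpace X] [CompactSpace X]
    [MeasurableSpace X] [BorelSpace X]
    (μ : Measure X) [IsFiniteMeasure μ] [μ.Regular] [μ.IsOpenPosMeasure]
    (Δ : X → X → ℝ)
    (hΔ : ∀ x y : X, Δ x y = ∫ z, dist x z * dist y z ∂μ)
    (ℓ : ℝ) (hℓ : 0 < ℓ)
    (hlow : ∀ x y : X, ℓ * dist x y ≤ Real.sqrt (∫ w, (Δ x w - Δ y w) ^ 2 ∂μ)) :
    ∃ (N : ℕ) (f : X → EuclideanSpace ℝ (Fin N)) (a b : ℝ), 0 < a ∧ a ≤ b ∧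
      ∀ x y : X, a * dist x y ≤ dist (f x) (f y) ∧ dist (f x) (f y) ≤ b * dist x y := by
  set m := μ.real Set.univ
  have hm : 0 ≤ m := measureReal_nonneg
  have hsm : Real.sqrt m ≤ m + 1 := Real.sqrt_le_iff.2 ⟨by linarith, by nlinarith⟩
  set P := m + 1
  have hP : 0 < P := by positivity
  obtain ⟨t, -, ht, hcov⟩ := Metric.finite_approx_of_totallyBounded
    (isCompact_univ (X := X)).totallyBounded (ℓ / (2 * P ^ 2)) (by positivity)
  have : Fintype t := ht.fintype
  let e := Fintype.equivFin t
  let f : X → EuclideanSpace ℝ (Fin (Fintype.card t)) :=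
    fun x => WithLp.toLp 2 fun i => Δ x (e.symm i)
  let B := Real.sqrt (Fintype.card t) * (Metric.diam (Set.univ : Set X) * m)
  refine ⟨_, f, ℓ / (2 * P), max (ℓ / (2 * P)) B, by positivity, le_max_left _ _,
    fun x y => ⟨?_, ?_⟩⟩
  · have hpt (w : X) : |Δ x w - Δ y w| ≤
        dist (f x) (f y) + dist x y * (ℓ / (2 * P ^ 2)) * P := by
      obtain ⟨v, hv, hwv⟩ := Set.mem_iUnion₂.1 (hcov (Set.mem_univ w))
      have h1 : |Δ x v - Δ y v| ≤ dist (f x) (f y) := by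
        simpa [f, dist_eq_norm] using PiLp.norm_apply_le (f x - f y) (e ⟨v, hv⟩)
      have h2 := abs_integral_dist_mul_dist_sub_le μ x y v w
      rw [← hΔ, ← hΔ, ← hΔ, ← hΔ] at h2
      have h3 : dist x y * dist w v * m ≤ dist x y * (ℓ / (2 * P ^ 2)) * P := by
        gcongr
        · exact (Metric.mem_ball.1 hwv).le
        · exact (lt_add_one m).le
      have h4 := abs_sub_abs_le_abs_sub (Δ x w - Δ y w) (Δ x v - Δ y v)
      linarith
    have hK : 0 ≤ dist (f x) (f y) + dist x y * (ℓ / (2 * P ^ 2)) * P := by positivity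
    have h := ((hlow x y).trans (sqrt_integral_sq_le_of_abs_le μ hK hpt)).trans
      (mul_le_mul_of_nonneg_left hsm hK)
    have h5 : (dist (f x) (f y) + dist x y * (ℓ / (2 * P ^ 2)) * P) * P =
        dist (f x) (f y) * P + ℓ * dist x y / 2 := by
      field_simp
    rw [h5] at h
    rw [div_mul_eq_mul_div, div_le_iff₀ (by positivity)]
    linarith
  · have h : dist (f x) (f y) ≤ B * dist x y := by
      refine (EuclideanSpace.dist_le_sqrt_mul_of_forall_dist_le
        (K := dist x y * Metric.diam (Set.univ : Set X) * m) (by positivity) fun i => ?_).trans_eq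
        (by rw [Fintype.card_fin]; ring)
      have h1 := abs_integral_dist_mul_dist_sub_le_diam μ x y (e.symm i)
      rwa [← hΔ, ← hΔ] at h1
    exact h.trans (mul_le_mul_of_nonneg_right (le_max_right _ _) dist_nonneg)
end

section
/- Let F : H₁ → H₂ be a compact linear map of real Hilbert spaces and let X ⊆ H₁ be a compact subset such that the restriction F|_X is bi-Lipschitz. Then F(X) is spherically compact (the set U(F(X)) = {(u − v)/‖u − v‖ : u, v ∈ F(X), u ≠ v} has compact closure in the norm topology of H₂) and X is weakly spherically compact (0 does not belong to the closure, in the weak topology of H₁, of U(X) = {(x − y)/‖x − y‖ : x, y ∈ X, x ≠ y}). -/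
/-- If `S` has relatively compact image under `F` and `F` is bounded away from zero on `S`, then
`0` is not in the weak closure of `S`. -/
theorem zero_notMem_weak_closure_of_compact {H₁ H₂ : Type*}
    [NormedAddCommGroup H₁] [NormedSpace ℝ H₁] [NormedAddCommGroup H₂] [NormedSpace ℝ H₂]
    (F : H₁ →L[ℝ] H₂) {S : Set H₁} (hFS : IsCompact (closure (F '' S)))
    {a : ℝ} (ha : 0 < a) (h : ∀ u ∈ S, a ≤ ‖F u‖) :
    (0 : WeakSpace ℝ H₁) ∉ closure (toWeakSpace ℝ H₁ '' S) := by
  have hclosed : IsClosed (toWeakSpace ℝ H₂ '' closure (F '' S)) :=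
    (hFS.image (toWeakSpaceCLM ℝ H₂).continuous).isClosed
  have hsub : closure (toWeakSpace ℝ H₁ '' S) ⊆
      WeakSpace.map F ⁻¹' (toWeakSpace ℝ H₂ '' closure (F '' S)) := by
    refine closure_minimal ?_ (hclosed.preimage (WeakSpace.map F).continuous)
    rintro _ ⟨u, hu, rfl⟩
    exact ⟨F u, subset_closure ⟨u, hu, rfl⟩, rfl⟩
  intro h0
  obtain ⟨z, hz, hz0⟩ := hsub h0
  rw [map_zero, LinearEquiv.map_eq_zero_iff] at hz0
  have hle : closure (F '' S) ⊆ {v : H₂ | a ≤ ‖v‖} := by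
    refine closure_minimal ?_ (isClosed_le continuous_const continuous_norm)
    rintro _ ⟨u, hu, rfl⟩
    exact h u hu
  have ha0 : a ≤ ‖z‖ := hle hz
  rw [hz0, norm_zero] at ha0
  exact absurd ha0 (not_le.mpr ha)

/-- **Lemma `complinear`.** Let `F : H₁ → H₂` be a compact linear map
of real Hilbert spaces and `X ⊆ H₁` a compact subset with `F|_X` bi-Lipschitz.  Then
`F(X)` is spherically compact (the normalized secants of `F(X)` have compact closure in
norm) and `X` itself is weakly spherically compact (`0` is not in the weak closure of
the normalized secants of `X`). -/
theorem spherically_compact_of_compact_linear_biLipschitz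
    {H₁ H₂ : Type*}
    [NormedAddCommGroup H₁] [InnerProductSpace ℝ H₁] [CompleteSpace H₁]
    [NormedAddCommGroup H₂] [InnerProductSpace ℝ H₂] [CompleteSpace H₂]
    (F : H₁ →L[ℝ] H₂)
    (hF : ∀ s : Set H₁, Bornology.IsBounded s → IsCompact (closure (F '' s)))
    (X : Set H₁) (hX : IsCompact X)
    (a b : ℝ) (ha : 0 < a) (hab : a ≤ b)
    (hbl : ∀ x ∈ X, ∀ y ∈ X,
      a * ‖x - y‖ ≤ ‖F x - F y‖ ∧ ‖F x - F y‖ ≤ b * ‖x - y‖) :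
    IsCompact (closure
      {u : H₂ | ∃ v ∈ F '' X, ∃ w ∈ F '' X, v ≠ w ∧ u = ‖v - w‖⁻¹ • (v - w)}) ∧
    (0 : WeakSpace ℝ H₁) ∉
      closure (toWeakSpace ℝ H₁ ''
        {u : H₁ | ∃ x ∈ X, ∃ y ∈ X, x ≠ y ∧ u = ‖x - y‖⁻¹ • (x - y)}) := by
  refine ⟨(hF (Metric.closedBall 0 a⁻¹) Metric.isBounded_closedBall).closure_of_subset ?_,
    zero_notMem_weak_closure_of_compact F (hF _ ?_) ha ?_⟩
  · rintro _ ⟨_, ⟨x, hx, rfl⟩, _, ⟨y, hy, rfl⟩, hne, rfl⟩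
    refine subset_closure ⟨‖F x - F y‖⁻¹ • (x - y), ?_, by rw [map_smul, map_sub]⟩
    have hpos : 0 < ‖F x - F y‖ := norm_pos_iff.mpr (sub_ne_zero.mpr hne)
    rw [mem_closedBall_zero_iff, norm_smul, norm_inv, norm_norm, inv_mul_le_iff₀ hpos,
      ← div_eq_mul_inv, le_div_iff₀ ha, mul_comm]
    exact (hbl x hx y hy).1
  · refine (Metric.isBounded_closedBall (x := (0 : H₁)) (r := 1)).subset ?_
    rintro _ ⟨x, -, y, -, -, rfl⟩
    rw [mem_closedBall_zero_iff, norm_smul, norm_inv, norm_norm]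
    exact inv_mul_le_one
  · rintro _ ⟨x, hx, y, hy, hne, rfl⟩
    have hpos : 0 < ‖x - y‖ := norm_pos_iff.mpr (sub_ne_zero.mpr hne)
    rw [map_smul, map_sub, norm_smul, norm_inv, norm_norm, le_inv_mul_iff₀ hpos, mul_comm]
    exact (hbl x hx y hy).1
end

section
/- Let (X, d, μ) be a metric-measure space with diam(X, d) < ∞, let 0 < s < 1 and 1 ≤ p < ∞, and consider the map ι(s) : (X, d^{s}) → L^{p}(μ) given by ι(s)(x) = d(x, ·). If ι(s) is bi-Lipschitz, i.e. there exist 0 < ℓ ≤ L with ℓ·d(x, y)^{s} ≤ ‖d(x, ·) − d(y, ·)‖_{L^{p}(μ)} ≤ L·d(x, y)^{s} for all x, y ∈ X, then the metric space (X, d) is discrete (every point of X is isolated). -/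
open MeasureTheory
open scoped Topology

/-- The canonical map `x ↦ d(x, ·)` into `L^p(μ)` is Lipschitz with constant `μ(X)^(1/p)`. -/
theorem integral_abs_dist_sub_rpow_le {X : Type*} [PseudoMetricSpace X] [MeasurableSpace X]
    (μ : Measure X) [IsFiniteMeasure μ] {p : ℝ} (hp : 0 < p) (x y : X) :
    (∫ z, |dist x z - dist y z| ^ p ∂μ) ^ (1 / p) ≤ dist x y * μ.real Set.univ ^ (1 / p) := by
  have hint : ∫ z, |dist x z - dist y z| ^ p ∂μ ≤ dist x y ^ p * μ.real Set.univ := by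
    calc ∫ z, |dist x z - dist y z| ^ p ∂μ ≤ ∫ _, dist x y ^ p ∂μ := by
          refine integral_mono_of_nonneg (Filter.Eventually.of_forall fun z => by positivity)
            (integrable_const _) (Filter.Eventually.of_forall fun z => ?_)
          exact Real.rpow_le_rpow (abs_nonneg _) (abs_dist_sub_le x y z) hp.le
      _ = dist x y ^ p * μ.real Set.univ := by
          rw [integral_const, smul_eq_mul, mul_comm]
  calc (∫ z, |dist x z - dist y z| ^ p ∂μ) ^ (1 / p)
      ≤ (dist x y ^ p * μ.real Set.univ) ^ (1 / p) :=
        Real.rpow_le_rpow (integral_nonneg fun z => by positivity) hint (by positivity)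
    _ = dist x y * μ.real Set.univ ^ (1 / p) := by
        rw [Real.mul_rpow (by positivity) measureReal_nonneg, one_div,
          Real.rpow_rpow_inv dist_nonneg hp.ne']

/-- **Corollary `iotas`.** Let `(X, d, μ)` be a metric-measure space of
finite diameter, `0 < s < 1` and `1 ≤ p < ∞`.  If the map
`ι(s) : (X, dˢ) → L^p(μ)`, `x ↦ d(x, ·)`, is bi-Lipschitz, i.e.
`ℓ·d(x,y)^s ≤ ‖d(x,·) − d(y,·)‖_p ≤ L·d(x,y)^s` for all `x, y`, then `(X, d)` is
discrete: every point of `X` is isolated. -/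
theorem discrete_of_snowflake_canonical_map_biLipschitz
    {X : Type*} [MetricSpace X]
    [MeasurableSpace X] [BorelSpace X]
    (μ : Measure X) [IsFiniteMeasure μ] [μ.Regular] [μ.IsOpenPosMeasure]
    (hμ : μ Set.univ ≠ 0)
    (hdiam : EMetric.diam (Set.univ : Set X) ≠ ⊤)
    (s : ℝ) (hs0 : 0 < s) (hs1 : s < 1)
    (p : ℝ) (hp : 1 ≤ p)
    (ℓ L : ℝ) (hℓ : 0 < ℓ) (hℓL : ℓ ≤ L)
    (hbl : ∀ x y : X,
      ℓ * dist x y ^ s ≤ (∫ z, |dist x z - dist y z| ^ p ∂μ) ^ (1 / p) ∧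
      (∫ z, |dist x z - dist y z| ^ p ∂μ) ^ (1 / p) ≤ L * dist x y ^ s) :
    ∀ x : X, 𝓝[≠] x = ⊥ := by
  intro x
  have hlim : Filter.Tendsto (fun y => dist x y ^ (1 - s) * μ.real Set.univ ^ (1 / p))
      (𝓝 x) (𝓝 0) := by
    have hdist : Filter.Tendsto (fun y => dist x y) (𝓝 x) (𝓝 0) := by
      simpa using (continuous_const.dist continuous_id : Continuous fun y => dist x y).tendsto x
    have := (hdist.rpow_const (p := 1 - s) (Or.inr (by linarith))).mul_const
      (μ.real Set.univ ^ (1 / p))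
    simpa [Real.zero_rpow (by linarith : 1 - s ≠ 0)] using this
  rw [← Filter.eventually_false_iff_eq_bot]
  filter_upwards [(hlim.eventually (gt_mem_nhds hℓ)).filter_mono nhdsWithin_le_nhds,
    self_mem_nhdsWithin] with y hy hne
  have hd : 0 < dist x y := dist_pos.2 (Ne.symm hne)
  have hle := (hbl x y).1.trans (integral_abs_dist_sub_rpow_le μ (by linarith) x y)
  have hsplit : dist x y ^ (1 - s) * dist x y ^ s = dist x y := by
    rw [← Real.rpow_add hd, sub_add_cancel, Real.rpow_one]
  have hlt := mul_lt_mul_of_pos_right hy (Real.rpow_pos_of_pos hd s)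
  rw [mul_right_comm, hsplit] at hlt
  exact absurd hle hlt.not_ge
end
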